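/- arXiv:2509.03034 — 10 statements merged into one kernel-verified Lean document; each statement's English description precedes it below -/
import Mathlib

section
/- Let q be a power of 2 and let f ∈ 𝔽_q[X] have degree 3. Let (α_1, β_1), …, (α_n, β_n) ∈ 𝔽_q × 𝔽_q be n pairwise distinct pairs with β_i² + β_i = f(α_i) for all i. If c, d ∈ 𝔽_q[X] satisfy 2·deg(c) ≤ n−1 and 2·deg(d) + 3 ≤ n−1, and c(α_i) + d(α_i)·β_i = 0 for all i = 1, …, n, then c = 0 and d = 0. -/
open Polynomial

/-- The norm `(c + d y) (c + d (-1 - y))` from the function field of `y ^ 2 + y = f`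
down to the rational functions. -/
noncomputable def curveNorm {R : Type*} [CommRing R] (f c d : R[X]) : R[X] :=
  c ^ 2 - c * d - d ^ 2 * f

theorem eval_curveNorm_eq_zero {R : Type*} [CommRing R] {f c d : R[X]} {a b : R}
    (hcurve : b ^ 2 + b = f.eval a) (hvan : c.eval a + d.eval a * b = 0) :
    (curveNorm f c d).eval a = 0 := by
  simp only [curveNorm, eval_sub, eval_pow, eval_mul, ← hcurve]
  linear_combination (c.eval a - d.eval a * (b + 1)) * hvan

theorem sq_dvd_curveNorm {R : Type*} [CommRing R] {f c d : R[X]} {a : R}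
    (hc : c.eval a = 0) (hd : d.eval a = 0) : (X - C a) ^ 2 ∣ curveNorm f c d := by
  obtain ⟨u, rfl⟩ := dvd_iff_isRoot.mpr hc
  obtain ⟨v, rfl⟩ := dvd_iff_isRoot.mpr hd
  exact ⟨u ^ 2 - u * v - v ^ 2 * f, by rw [curveNorm]; ring⟩

theorem eq_zero_of_curveNorm_eq_zero {R : Type*} [CommRing R] [IsDomain R] {f c d : R[X]}
    (hdeg : f.natDegree = 3) (h : curveNorm f c d = 0) : c = 0 ∧ d = 0 := by
  have hd : d = 0 := by
    by_contra hd
    have hf : f ≠ 0 := by rintro rfl; simp at hdeg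
    have heq : c * (c - d) = d ^ 2 * f := by rw [curveNorm] at h; linear_combination h
    have hne : c * (c - d) ≠ 0 := heq ▸ mul_ne_zero (pow_ne_zero 2 hd) hf
    have hnat := congrArg natDegree heq
    rw [natDegree_mul (left_ne_zero_of_mul hne) (right_ne_zero_of_mul hne),
      natDegree_mul (pow_ne_zero 2 hd) hf, natDegree_pow, hdeg] at hnat
    rcases le_or_gt c.natDegree d.natDegree with hle | hlt
    · have := natDegree_sub_le c d
      rw [max_eq_right hle] at this
      omega
    · rw [natDegree_sub_eq_left_of_natDegree_lt hlt] at hnat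
      omega
  subst hd
  simpa [curveNorm] using h

theorem natDegree_curveNorm_le {R : Type*} [CommRing R] {f c d : R[X]} {m : ℕ}
    (hdeg : f.natDegree ≤ 3) (hc : 2 * c.natDegree ≤ m) (hd : 2 * d.natDegree + 3 ≤ m) :
    (curveNorm f c d).natDegree ≤ m := by
  have hcc : (c ^ 2).natDegree ≤ 2 * c.natDegree := natDegree_pow_le
  have hdd : (d ^ 2).natDegree ≤ 2 * d.natDegree := natDegree_pow_le
  have hcd : (c * d).natDegree ≤ c.natDegree + d.natDegree := natDegree_mul_le
  have hdf : (d ^ 2 * f).natDegree ≤ (d ^ 2).natDegree + f.natDegree := natDegree_mul_le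
  have hsub := natDegree_sub_le (c ^ 2) (c * d)
  have hnorm := natDegree_sub_le (c ^ 2 - c * d) (d ^ 2 * f)
  rw [curveNorm]
  omega

theorem add_eq_neg_one_of_sq_add_self_eq {R : Type*} [CommRing R] [IsDomain R] {x y : R}
    (h : x ^ 2 + x = y ^ 2 + y) (hne : x ≠ y) : x + y = -1 := by
  refine mul_left_cancel₀ (sub_ne_zero.mpr hne) ?_
  linear_combination h

/-- The fibre of the points over `a` is no larger than the multiplicity of `a` as a root of the
norm. -/
theorem card_fiber_le_rootMultiplicity_curveNorm {R ι : Type*} [CommRing R] [IsDomain R]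
    [DecidableEq R] [Fintype ι] {f c d : R[X]} {α β : ι → R}
    (hdist : Function.Injective (fun i => (α i, β i)))
    (hcurve : ∀ i, β i ^ 2 + β i = f.eval (α i))
    (hvan : ∀ i, c.eval (α i) + d.eval (α i) * β i = 0)
    (hN : curveNorm f c d ≠ 0) (a : R) :
    (Finset.univ.filter fun i => a = α i).card ≤ (curveNorm f c d).rootMultiplicity a := by
  have hβ : ∀ i j, a = α i → a = α j → i ≠ j → β i ≠ β j := fun i j hi hj hij hb =>
    hij (hdist (Prod.ext (hi.symm.trans hj) hb))
  have hadd : ∀ i j, a = α i → a = α j → i ≠ j → β i + β j = -1 := fun i j hi hj hij =>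
    add_eq_neg_one_of_sq_add_self_eq (by rw [hcurve, hcurve, ← hi, ← hj]) (hβ i j hi hj hij)
  have hle : (Finset.univ.filter fun i => a = α i).card ≤ 2 := by
    by_contra! hlt
    obtain ⟨i, j, k, hi, hj, hk, hij, hik, hjk⟩ := Finset.two_lt_card_iff.mp hlt
    simp only [Finset.mem_filter, Finset.mem_univ, true_and] at hi hj hk
    exact hβ j k hj hk hjk (add_left_cancel ((hadd i j hi hj hij).trans (hadd i k hi hk hik).symm))
  by_cases hone : 1 < (Finset.univ.filter fun i => a = α i).card
  · obtain ⟨i, hi, j, hj, hij⟩ := Finset.one_lt_card.mp hone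
    simp only [Finset.mem_filter, Finset.mem_univ, true_and] at hi hj
    have hvi := hvan i
    have hvj := hvan j
    rw [← hi] at hvi
    rw [← hj] at hvj
    have hda : d.eval a = 0 := by
      refine (mul_eq_zero.mp ?_).resolve_right (sub_ne_zero.mpr (hβ i j hi hj hij))
      linear_combination hvi - hvj
    have hca : c.eval a = 0 := by simpa [hda] using hvi
    exact hle.trans ((le_rootMultiplicity_iff hN).mpr (sq_dvd_curveNorm hca hda))
  · rcases Finset.eq_empty_or_nonempty (Finset.univ.filter fun i => a = α i) with h | ⟨i, hi⟩
    · simp [h]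
    · simp only [Finset.mem_filter, Finset.mem_univ, true_and] at hi
      refine (not_lt.mp hone).trans ((rootMultiplicity_pos hN).mpr ?_)
      rw [hi]
      exact eval_curveNorm_eq_zero (hcurve i) (hvan i)

theorem card_le_natDegree_curveNorm {R ι : Type*} [CommRing R] [IsDomain R] [Fintype ι]
    {f c d : R[X]} {α β : ι → R}
    (hdist : Function.Injective (fun i => (α i, β i)))
    (hcurve : ∀ i, β i ^ 2 + β i = f.eval (α i))
    (hvan : ∀ i, c.eval (α i) + d.eval (α i) * β i = 0)
    (hN : curveNorm f c d ≠ 0) :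
    Fintype.card ι ≤ (curveNorm f c d).natDegree := by
  classical
  have hle : Finset.univ.val.map α ≤ (curveNorm f c d).roots := by
    refine Multiset.le_iff_count.mpr fun a => ?_
    rw [Multiset.count_map, count_roots]
    exact card_fiber_le_rootMultiplicity_curveNorm hdist hcurve hvan hN a
  simpa using (Multiset.card_le_card hle).trans (card_roots' _)

theorem stmt_1 (F : Type*) [Field F] [Fintype F] (hchar : ringChar F = 2)
    (f : F[X]) (hdeg : f.natDegree = 3)
    (n : ℕ) (α β : Fin n → F)
    (hdist : Function.Injective (fun i => (α i, β i)))
    (hcurve : ∀ i, β i ^ 2 + β i = f.eval (α i))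
    (c d : F[X])
    (hc : 2 * c.natDegree ≤ n - 1)
    (hd : 2 * d.natDegree + 3 ≤ n - 1)
    (hvan : ∀ i, c.eval (α i) + d.eval (α i) * β i = 0) :
    c = 0 ∧ d = 0 := by
  refine eq_zero_of_curveNorm_eq_zero hdeg (by_contra fun hN => ?_)
  have hcard := card_le_natDegree_curveNorm hdist hcurve hvan hN
  have hnat := natDegree_curveNorm_le hdeg.le hc hd
  rw [Fintype.card_fin] at hcard
  omega
end

section
/- Let q be a power of 2 and a, b ∈ 𝔽_q with a ≠ 0. Let (α_1, β_1), …, (α_n, β_n) ∈ 𝔽_q × 𝔽_q be n pairwise distinct pairs with a·α_i + b ≠ 0 and β_i² + β_i = α_i + 1/(a·α_i + b) for all i. If c, d ∈ 𝔽_q[X] satisfy 2·deg(c) ≤ n−1 and 2·deg(d) + 3 ≤ n−1, and c(α_i) + d(α_i)·(a·α_i + b)·β_i = 0 for all i = 1, …, n, then c = 0 and d = 0. -/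
open Polynomial

/-- The norm of `c + d * u * β` where `u = a * X + b` and `β ^ 2 + β = X + u⁻¹`,
in characteristic two. -/
noncomputable def normPoly {F : Type*} [Field F] (a b : F) (c d : F[X]) : F[X] :=
  c ^ 2 + c * d * (C a * X + C b) + d ^ 2 * (C a * X + C b)
    + d ^ 2 * (X * (C a * X + C b) ^ 2)

section

variable {F : Type*} [Field F] {a b : F} {c d : F[X]}

lemma natDegree_normPoly_lt {n : ℕ} (hc : 2 * c.natDegree ≤ n - 1)
    (hd : 2 * d.natDegree + 3 ≤ n - 1) : (normPoly a b c d).natDegree < n := by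
  have hu : (C a * X + C b).natDegree ≤ 1 := natDegree_linear_le
  have h1 : (c ^ 2).natDegree ≤ n - 1 := natDegree_pow_le.trans hc
  have h2 : (c * d * (C a * X + C b)).natDegree ≤ n - 1 := by
    have := natDegree_mul_le (p := c * d) (q := C a * X + C b)
    have := natDegree_mul_le (p := c) (q := d)
    omega
  have h3 : (d ^ 2 * (C a * X + C b)).natDegree ≤ n - 1 := by
    have := natDegree_mul_le (p := d ^ 2) (q := C a * X + C b)
    have := natDegree_pow_le (p := d) (n := 2)
    omega
  have h4 : (d ^ 2 * (X * (C a * X + C b) ^ 2)).natDegree ≤ n - 1 := by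
    have := natDegree_mul_le (p := d ^ 2) (q := X * (C a * X + C b) ^ 2)
    have := natDegree_pow_le (p := d) (n := 2)
    have := natDegree_mul_le (p := X) (q := (C a * X + C b) ^ 2)
    have := natDegree_pow_le (p := C a * X + C b) (n := 2)
    have := natDegree_X_le (R := F)
    omega
  have : (normPoly a b c d).natDegree ≤ n - 1 :=
    natDegree_add_le_of_degree_le
      (natDegree_add_le_of_degree_le (natDegree_add_le_of_degree_le h1 h2) h3) h4
  omega

/-- The norm form is anisotropic: its two square terms have degrees of opposite parity, and the
larger one dominates the other terms. -/
lemma eq_zero_of_normPoly_eq_zero (ha : a ≠ 0) (h : normPoly a b c d = 0) :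
    c = 0 ∧ d = 0 := by
  unfold normPoly at h
  rcases eq_or_ne d 0 with rfl | hd
  · simpa using h
  exfalso
  have hu : (C a * X + C b).natDegree = 1 := natDegree_linear ha
  have hu0 : C a * X + C b ≠ 0 := ne_zero_of_natDegree_gt (n := 0) (by omega)
  generalize C a * X + C b = u at *
  have h4 : (d ^ 2 * (X * u ^ 2)).natDegree = 2 * d.natDegree + 3 := by
    rw [natDegree_mul (pow_ne_zero _ hd) (mul_ne_zero X_ne_zero (pow_ne_zero _ hu0)),
      natDegree_mul X_ne_zero (pow_ne_zero _ hu0)]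
    simp only [natDegree_pow, natDegree_X, hu]
  have h3 : (d ^ 2 * u).natDegree = 2 * d.natDegree + 1 := by
    rw [natDegree_mul (pow_ne_zero _ hd) hu0, natDegree_pow, hu]
  have h2 : (c * d * u).natDegree ≤ c.natDegree + d.natDegree + 1 := by
    have := natDegree_mul_le (p := c * d) (q := u)
    have := natDegree_mul_le (p := c) (q := d)
    omega
  have h1 : (c ^ 2).natDegree = 2 * c.natDegree := natDegree_pow c 2
  rcases le_or_gt c.natDegree (d.natDegree + 1) with hcd | hcd
  · have e : d ^ 2 * (X * u ^ 2) = -(c ^ 2 + c * d * u + d ^ 2 * u) := by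
      linear_combination h
    have : (c ^ 2 + c * d * u + d ^ 2 * u).natDegree ≤ 2 * d.natDegree + 2 :=
      natDegree_add_le_of_degree_le
        (natDegree_add_le_of_degree_le (by omega) (by omega)) (by omega)
    rw [e, natDegree_neg] at h4
    omega
  · have e : c ^ 2 = -(c * d * u + d ^ 2 * u + d ^ 2 * (X * u ^ 2)) := by
      linear_combination h
    have : (c * d * u + d ^ 2 * u + d ^ 2 * (X * u ^ 2)).natDegree ≤ 2 * c.natDegree - 1 :=
      natDegree_add_le_of_degree_le
        (natDegree_add_le_of_degree_le (by omega) (by omega)) (by omega)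
    rw [e, natDegree_neg] at h1
    omega

lemma eval_normPoly_eq_zero [CharP F 2] {x y : F} (hx : a * x + b ≠ 0)
    (hxy : y ^ 2 + y = x + (a * x + b)⁻¹)
    (h : c.eval x + d.eval x * (a * x + b) * y = 0) : (normPoly a b c d).eval x = 0 := by
  have hcurve : (y ^ 2 + y) * (a * x + b) = x * (a * x + b) + 1 := by
    rw [hxy, add_mul, inv_mul_cancel₀ hx]
  have h2 : (2 : F) = 0 := CharTwo.two_eq_zero
  simp only [normPoly, eval_add, eval_mul, eval_pow, eval_C, eval_X]
  linear_combination (c.eval x + d.eval x * (a * x + b) * (y + 1)) * h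
    - d.eval x ^ 2 * (a * x + b) * hcurve - (c.eval x * d.eval x * (a * x + b) * y) * h2

lemma sq_dvd_normPoly {p : F[X]} (hc : p ∣ c) (hd : p ∣ d) : p ^ 2 ∣ normPoly a b c d := by
  obtain ⟨r, rfl⟩ := hc
  obtain ⟨s, rfl⟩ := hd
  exact ⟨normPoly a b r s, by unfold normPoly; ring⟩

/-- In characteristic two, `y` and `y + 1` are the only roots of `T ^ 2 + T = y ^ 2 + y`. -/
lemma eq_or_eq_add_one_of_sq_add_self_eq [CharP F 2] {y z : F} (h : z ^ 2 + z = y ^ 2 + y) :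
    z = y ∨ z = y + 1 := by
  have h2 : (2 : F) = 0 := CharTwo.two_eq_zero
  have : (z - y) * (z - (y + 1)) = 0 := by
    linear_combination h + (y ^ 2 + y - z * y - z) * h2
  rcases mul_eq_zero.1 this with h | h
  · exact .inl (sub_eq_zero.1 h)
  · exact .inr (sub_eq_zero.1 h)

end

lemma map_le_roots_normPoly {F : Type*} [Field F] [CharP F 2] {a b : F}
    {ι : Type*} [Fintype ι] {α β : ι → F}
    (hdist : Function.Injective (fun i => (α i, β i)))
    (hden : ∀ i, a * α i + b ≠ 0)
    (hcurve : ∀ i, β i ^ 2 + β i = α i + (a * α i + b)⁻¹)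
    {c d : F[X]} (hvan : ∀ i, c.eval (α i) + d.eval (α i) * (a * α i + b) * β i = 0)
    (hN : normPoly a b c d ≠ 0) :
    Finset.univ.val.map α ≤ (normPoly a b c d).roots := by
  classical
  refine Multiset.le_iff_count.2 fun x => ?_
  rw [count_roots, Multiset.count_map]
  change (Finset.univ.filter fun i => x = α i).card ≤ _
  rcases le_or_gt (Finset.univ.filter fun i => x = α i).card 1 with hcard | hcard
  · rcases (Finset.univ.filter fun i => x = α i).eq_empty_or_nonempty with he | ⟨i, hi⟩
    · simp [he]
    · obtain rfl := (Finset.mem_filter.1 hi).2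
      exact hcard.trans ((rootMultiplicity_pos hN).2
        (eval_normPoly_eq_zero (hden i) (hcurve i) (hvan i)))
  · obtain ⟨i, hi, j, hj, hij⟩ := Finset.one_lt_card.1 hcard
    obtain rfl := (Finset.mem_filter.1 hi).2
    have hj' : α i = α j := (Finset.mem_filter.1 hj).2
    have hβ : β i - β j ≠ 0 := fun h => hij (hdist (Prod.ext hj' (sub_eq_zero.1 h)))
    have hdi : d.eval (α i) = 0 := by
      have := hvan j
      rw [← hj'] at this
      have : d.eval (α i) * ((a * α i + b) * (β i - β j)) = 0 := by
        linear_combination hvan i - this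
      exact (mul_eq_zero.1 this).resolve_right (mul_ne_zero (hden i) hβ)
    have hci : c.eval (α i) = 0 := by simpa [hdi] using hvan i
    refine le_trans ?_ ((le_rootMultiplicity_iff hN).2
      (sq_dvd_normPoly (dvd_iff_isRoot.2 hci) (dvd_iff_isRoot.2 hdi)))
    refine le_trans (Finset.card_le_card_of_injOn β (t := {β i, β i + 1}) ?_ ?_)
      Finset.card_le_two
    · intro k hk
      have hk' : α i = α k := by simpa using hk
      have := eq_or_eq_add_one_of_sq_add_self_eq (y := β i) (z := β k)
        (by rw [hcurve, hcurve, hk'])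
      simpa using this
    · intro k hk l hl hkl
      have hk' : α i = α k := by simpa using hk
      have hl' : α i = α l := by simpa using hl
      exact hdist (Prod.ext (hk'.symm.trans hl') hkl)

theorem stmt_2 (F : Type*) [Field F] [Fintype F] (hchar : ringChar F = 2)
    (a b : F) (ha : a ≠ 0)
    (n : ℕ) (α β : Fin n → F)
    (hdist : Function.Injective (fun i => (α i, β i)))
    (hden : ∀ i, a * α i + b ≠ 0)
    (hcurve : ∀ i, β i ^ 2 + β i = α i + (a * α i + b)⁻¹)
    (c d : F[X])
    (hc : 2 * c.natDegree ≤ n - 1)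
    (hd : 2 * d.natDegree + 3 ≤ n - 1)
    (hvan : ∀ i, c.eval (α i) + d.eval (α i) * (a * α i + b) * β i = 0) :
    c = 0 ∧ d = 0 := by
  have : CharP F 2 := ringChar.of_eq hchar
  refine eq_zero_of_normPoly_eq_zero (b := b) ha (by_contra fun hN => ?_)
  have hle := Multiset.card_le_card (map_le_roots_normPoly hdist hden hcurve hvan hN)
  have hroots := card_roots' (normPoly a b c d)
  have hdeg := natDegree_normPoly_lt (a := a) (b := b) hc hd
  simp only [Multiset.card_map, Finset.card_val, Finset.card_univ, Fintype.card_fin] at hle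
  omega
end

section
/- Let q be a power of an odd prime, f ∈ 𝔽_q[X] square-free of degree 3, and let D consist of n pairwise distinct affine points P_i = (α_i, β_i) of y² = f(x). For every k with 3 ≤ k ≤ n−1, the k vectors ev_D(x^a) for 0 ≤ a ≤ ⌊k/2⌋ together with ev_D(x^b y) for 0 ≤ b ≤ ⌊(k−3)/2⌋ are linearly independent over 𝔽_q; consequently the elliptic curve code C_L(D, kO) has dimension k. -/
open Polynomial

/-- On a curve `y² = f(x)` of odd degree, the norm `c² - f d²` of `c + d y` vanishes only if
`c = d = 0`. -/
theorem eq_zero_of_sq_eq_mul_sq {F : Type*} [Field F] {f c d : F[X]} (hf : Odd f.natDegree)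
    (h : c ^ 2 - f * d ^ 2 = 0) : c = 0 ∧ d = 0 := by
  have hf0 : f ≠ 0 := by
    rintro rfl
    simp at hf
  have hcd : c ^ 2 = f * d ^ 2 := sub_eq_zero.mp h
  have hd : d = 0 := by
    by_contra hd
    have hdeg := congrArg natDegree hcd
    rw [natDegree_mul hf0 (pow_ne_zero 2 hd), natDegree_pow, natDegree_pow] at hdeg
    obtain ⟨m, hm⟩ := hf
    omega
  subst hd
  exact ⟨by simpa using hcd, rfl⟩

/-- The `x`-coordinates of distinct zeros of `c + d y` on `y² = f(x)` are, with multiplicity,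
roots of the norm `c² - f d²`. -/
theorem map_le_roots_norm {F ι : Type*} [Field F] [Fintype ι] {f c d : F[X]} {α β : ι → F}
    (hdist : Function.Injective (fun i => (α i, β i)))
    (hcurve : ∀ i, β i ^ 2 = f.eval (α i))
    (hzero : ∀ i, c.eval (α i) + d.eval (α i) * β i = 0)
    (hN : c ^ 2 - f * d ^ 2 ≠ 0) :
    (Finset.univ : Finset ι).val.map α ≤ (c ^ 2 - f * d ^ 2).roots := by
  classical
  have hne : ∀ i j, i ≠ j → α i = α j → β i ≠ β j := fun i j hij hα hβ =>
    hij (hdist (Prod.ext hα hβ))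
  have hneg : ∀ i j, i ≠ j → α i = α j → β j = -β i := by
    intro i j hij hα
    have hsq : β j ^ 2 = β i ^ 2 := by rw [hcurve, hcurve, hα]
    exact (sq_eq_sq_iff_eq_or_eq_neg.mp hsq).resolve_left (hne i j hij hα).symm
  rw [Multiset.le_iff_count]
  intro a
  rw [count_roots, Multiset.count_map, ← Finset.filter_val, Finset.card_val]
  set s := Finset.univ.filter fun i => a = α i with hs
  have hmem : ∀ i ∈ s, a = α i := fun i hi => (Finset.mem_filter.mp hi).2
  have hle : s.card ≤ 2 := by
    by_contra! hlt
    obtain ⟨i, j, l, hi, hj, hl, hij, hil, hjl⟩ := Finset.two_lt_card_iff.mp hlt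
    have ei := hmem i hi
    have ej := hmem j hj
    have el := hmem l hl
    exact hne j l hjl (ej.symm.trans el)
      ((hneg i j hij (ei.symm.trans ej)).trans (hneg i l hil (ei.symm.trans el)).symm)
  rw [le_rootMultiplicity_iff hN]
  rcases Nat.lt_or_ge 1 s.card with h1 | h1
  · obtain ⟨i, hi, j, hj, hij⟩ := Finset.one_lt_card.mp h1
    have ei := hmem i hi
    have ej := hmem j hj
    have zi := hzero i
    have zj := hzero j
    rw [← ei] at zi
    rw [← ej] at zj
    have hd : d.eval a = 0 := by
      have hmul : d.eval a * (β i - β j) = 0 := by linear_combination zi - zj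
      exact (mul_eq_zero.mp hmul).resolve_right
        (sub_ne_zero.mpr (hne i j hij (ei.symm.trans ej)))
    have hc : c.eval a = 0 := by simpa [hd] using zi
    refine (pow_dvd_pow _ hle).trans (dvd_sub ?_ (Dvd.dvd.mul_left ?_ f))
    · exact pow_dvd_pow_of_dvd (dvd_iff_isRoot.mpr hc) 2
    · exact pow_dvd_pow_of_dvd (dvd_iff_isRoot.mpr hd) 2
  · rcases s.eq_empty_or_nonempty with h0 | ⟨i, hi⟩
    · simp [h0]
    · refine (pow_dvd_pow _ h1).trans ?_
      rw [pow_one, dvd_iff_isRoot, hmem i hi]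
      simp only [IsRoot.def, eval_sub, eval_mul, eval_pow, ← hcurve]
      linear_combination (c.eval (α i) - d.eval (α i) * β i) * hzero i

/-- A function `c + d y` on `y² = f(x)` with more zeros than the degree of its norm is zero. -/
theorem eq_zero_of_natDegree_norm_lt {F ι : Type*} [Field F] [Fintype ι] {f c d : F[X]}
    {α β : ι → F} (hf : Odd f.natDegree)
    (hdist : Function.Injective (fun i => (α i, β i)))
    (hcurve : ∀ i, β i ^ 2 = f.eval (α i))
    (hzero : ∀ i, c.eval (α i) + d.eval (α i) * β i = 0)
    (hlt : (c ^ 2 - f * d ^ 2).natDegree < Fintype.card ι) : c = 0 ∧ d = 0 := by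
  by_contra hcd
  have hN : c ^ 2 - f * d ^ 2 ≠ 0 := fun h => hcd (eq_zero_of_sq_eq_mul_sq hf h)
  have hcard := Multiset.card_le_card (map_le_roots_norm hdist hcurve hzero hN)
  rw [Multiset.card_map, Finset.card_val, Finset.card_univ] at hcard
  exact absurd (hcard.trans (card_roots' _)) (not_le.mpr hlt)

theorem natDegree_sum_fin_le {R : Type*} [Semiring R] {m : ℕ} (g : Fin (m + 1) → R) :
    (∑ a, C (g a) * X ^ (a : ℕ)).natDegree ≤ m :=
  natDegree_sum_le_of_forall_le _ _ fun a _ =>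
    (natDegree_C_mul_X_pow_le _ _).trans (Nat.lt_succ_iff.mp a.2)

theorem coeff_sum_fin {R : Type*} [Semiring R] {m : ℕ} (g : Fin m → R) (a : Fin m) :
    (∑ b, C (g b) * X ^ (b : ℕ)).coeff a = g a := by
  simp [coeff_C_mul, coeff_X_pow, Fin.val_inj]

theorem stmt_3 (F : Type*) [Field F] [Fintype F] (hchar : ringChar F ≠ 2)
    (f : F[X]) (hsf : Squarefree f) (hdeg : f.natDegree = 3)
    (n : ℕ) (α β : Fin n → F)
    (hdist : Function.Injective (fun i => (α i, β i)))
    (hcurve : ∀ i, β i ^ 2 = f.eval (α i))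
    (k : ℕ) (hk3 : 3 ≤ k) (hkn : k ≤ n - 1)
    (e : Fin (k / 2 + 1) ⊕ Fin ((k - 3) / 2 + 1) → Fin n → F)
    (he : e = Sum.elim
      (fun (a : Fin (k / 2 + 1)) => fun i => α i ^ (a : ℕ))
      (fun (b : Fin ((k - 3) / 2 + 1)) => fun i => α i ^ (b : ℕ) * β i)) :
    LinearIndependent F e ∧
      Module.finrank F ↥(Submodule.span F (Set.range e)) = k := by
  have hli : LinearIndependent F e := by
    subst he
    rw [Fintype.linearIndependent_iff]
    intro g hg
    set c : F[X] := ∑ a, C (g (Sum.inl a)) * X ^ (a : ℕ) with hc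
    set d : F[X] := ∑ b, C (g (Sum.inr b)) * X ^ (b : ℕ) with hd
    have hcdeg : c.natDegree ≤ k / 2 := natDegree_sum_fin_le fun a => g (Sum.inl a)
    have hddeg : d.natDegree ≤ (k - 3) / 2 := natDegree_sum_fin_le fun b => g (Sum.inr b)
    have hzero : ∀ i, c.eval (α i) + d.eval (α i) * β i = 0 := by
      intro i
      simpa [hc, hd, Fintype.sum_sum_type, eval_finsetSum, Finset.sum_mul, mul_assoc]
        using congrFun hg i
    have hlt : (c ^ 2 - f * d ^ 2).natDegree < Fintype.card (Fin n) := by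
      have h1 : (c ^ 2).natDegree ≤ 2 * c.natDegree := natDegree_pow_le
      have h2 : (d ^ 2).natDegree ≤ 2 * d.natDegree := natDegree_pow_le
      have h3 : (f * d ^ 2).natDegree ≤ f.natDegree + (d ^ 2).natDegree := natDegree_mul_le
      have h4 := natDegree_sub_le (c ^ 2) (f * d ^ 2)
      rw [Fintype.card_fin]
      omega
    obtain ⟨hc0, hd0⟩ := eq_zero_of_natDegree_norm_lt (by rw [hdeg]; decide)
      hdist hcurve hzero hlt
    rintro (a | b)
    · rw [← coeff_sum_fin (fun a => g (Sum.inl a)) a, ← hc, hc0, coeff_zero]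
    · rw [← coeff_sum_fin (fun b => g (Sum.inr b)) b, ← hd, hd0, coeff_zero]
  refine ⟨hli, ?_⟩
  rw [finrank_span_eq_card hli, Fintype.card_sum, Fintype.card_fin, Fintype.card_fin]
  omega
end

section
/- Let q be a power of an odd prime, f ∈ 𝔽_q[X] square-free of degree 3, and let D consist of n pairwise distinct affine points P_i = (α_i, β_i) of y² = f(x). Let k be even with 4 ≤ k ≤ n−2, let 0 ≤ ℓ ≤ k/2 and η ∈ 𝔽_q^*. Then the k vectors ev_D(x^a) for 0 ≤ a ≤ k/2 with a ≠ ℓ, ev_D(x^b y) for 0 ≤ b ≤ (k−4)/2, and ev_D(x^ℓ + η x^{(k−2)/2} y) are linearly independent over 𝔽_q; consequently the twisted elliptic curve code C(D, kO, ℓ, η) has dimension k. -/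
open Polynomial

/-- A nonzero function `c + d y` whose norm `c ^ 2 - d ^ 2 * f` is nonzero has at most as many
zeros on the affine curve `y ^ 2 = f` as the degree of that norm. -/
theorem card_zeros_le_natDegree_norm {F : Type*} [Field F]
    {ι : Type*} [Fintype ι] (f c d : F[X]) (α β : ι → F)
    (hdist : Function.Injective (fun i => (α i, β i)))
    (hcurve : ∀ i, β i ^ 2 = f.eval (α i))
    (hzero : ∀ i, c.eval (α i) + d.eval (α i) * β i = 0)
    (hN : c ^ 2 - d ^ 2 * f ≠ 0) :
    Fintype.card ι ≤ (c ^ 2 - d ^ 2 * f).natDegree := by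
  classical
  have hle : (Finset.univ : Finset ι).val.map α ≤ (c ^ 2 - d ^ 2 * f).roots := by
    rw [Multiset.le_iff_count]
    intro a
    rw [Multiset.count_map, count_roots]
    change (Finset.univ.filter fun i => a = α i).card ≤ _
    set S := Finset.univ.filter fun i => a = α i with hS
    have hmem : ∀ i ∈ S, a = α i := fun i hi => (Finset.mem_filter.1 hi).2
    rcases Nat.lt_or_ge 1 S.card with h1 | h1
    · obtain ⟨i, hi, j, hj, hij⟩ := Finset.one_lt_card.1 h1
      have hai := hmem i hi
      have haj := hmem j hj
      have hβ : β i - β j ≠ 0 := by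
        intro h
        exact hij (hdist (Prod.ext (hai.symm.trans haj) (sub_eq_zero.1 h)))
      have hzi := hzero i
      have hzj := hzero j
      rw [← hai] at hzi
      rw [← haj] at hzj
      have hd : d.eval a = 0 := by
        have : d.eval a * (β i - β j) = 0 := by linear_combination hzi - hzj
        exact (mul_eq_zero.1 this).resolve_right hβ
      have hc : c.eval a = 0 := by simpa [hd] using hzi
      have hcard : S.card ≤ 2 := by
        have hsub : S.image β ⊆ {β i, -β i} := by
          intro b hb
          obtain ⟨m, hm, rfl⟩ := Finset.mem_image.1 hb
          have : β m ^ 2 = β i ^ 2 := by rw [hcurve, hcurve, ← hmem m hm, ← hai]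
          simpa using sq_eq_sq_iff_eq_or_eq_neg.1 this
        rw [← Finset.card_image_of_injOn (f := β) (s := S)]
        · exact (Finset.card_le_card hsub).trans Finset.card_le_two
        · intro m hm p hp h
          exact hdist (Prod.ext ((hmem m hm).symm.trans (hmem p hp)) h)
      refine hcard.trans ((le_rootMultiplicity_iff hN).2 ?_)
      exact dvd_sub (pow_dvd_pow_of_dvd (dvd_iff_isRoot.2 hc) 2)
        ((pow_dvd_pow_of_dvd (dvd_iff_isRoot.2 hd) 2).mul_right f)
    · rcases S.eq_empty_or_nonempty with h0 | ⟨i, hi⟩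
      · simp [h0]
      · refine h1.trans ((rootMultiplicity_pos hN).2 ?_)
        rw [hmem i hi, IsRoot.def, eval_sub, eval_mul, eval_pow, eval_pow, ← hcurve]
        linear_combination (c.eval (α i) - d.eval (α i) * β i) * hzero i
  simpa using (Multiset.card_le_card hle).trans (card_roots' _)

/-- If `f` has odd degree, then the norm `c ^ 2 - d ^ 2 * f` vanishes only for `c = d = 0`. -/
theorem eq_zero_of_sq_sub_sq_mul_eq_zero {F : Type*} [Field F] {f c d : F[X]}
    (hf : Odd f.natDegree) (h : c ^ 2 - d ^ 2 * f = 0) : c = 0 ∧ d = 0 := by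
  have hf0 : f ≠ 0 := by
    rintro rfl
    simp at hf
  rw [sub_eq_zero] at h
  by_cases hd : d = 0
  · subst hd
    simpa using h
  · have hdeg := congrArg natDegree h
    rw [natDegree_mul (pow_ne_zero 2 hd) hf0, natDegree_pow, natDegree_pow] at hdeg
    obtain ⟨m, hm⟩ := hf
    omega

/-- A function `c + d y` on `y ^ 2 = f` with more zeros than its pole order allows is zero. -/
theorem eq_zero_of_many_zeros {F : Type*} [Field F]
    {ι : Type*} [Fintype ι] {f c d : F[X]} (hf : f.natDegree = 3) (α β : ι → F)
    (hdist : Function.Injective (fun i => (α i, β i)))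
    (hcurve : ∀ i, β i ^ 2 = f.eval (α i))
    (hzero : ∀ i, c.eval (α i) + d.eval (α i) * β i = 0)
    (hc : 2 * c.natDegree < Fintype.card ι) (hd : 2 * d.natDegree + 3 < Fintype.card ι) :
    c = 0 ∧ d = 0 := by
  apply eq_zero_of_sq_sub_sq_mul_eq_zero (f := f) (by rw [hf]; decide)
  by_contra hN
  have hcard := card_zeros_le_natDegree_norm f c d α β hdist hcurve hzero hN
  have hsub := natDegree_sub_le (c ^ 2) (d ^ 2 * f)
  have hmul : (d ^ 2 * f).natDegree ≤ (d ^ 2).natDegree + f.natDegree := natDegree_mul_le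
  rw [natDegree_pow] at hsub hmul
  omega

theorem coeff_sum_fin_C_mul_X_pow {F : Type*} [Field F] {m : ℕ} (g : Fin m → F) (j : Fin m) :
    (∑ i, C (g i) * X ^ (i : ℕ)).coeff j = g j := by
  simp [coeff_X_pow, Fin.val_inj]

theorem natDegree_sum_fin_C_mul_X_pow_le {F : Type*} [Field F] {m : ℕ} (g : Fin m → F) :
    (∑ i, C (g i) * X ^ (i : ℕ)).natDegree ≤ m - 1 :=
  natDegree_sum_le_of_forall_le _ _ fun i _ => (natDegree_C_mul_X_pow_le _ _).trans (by omega)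

theorem stmt_5 (F : Type*) [Field F] [Fintype F] (hchar : ringChar F ≠ 2)
    (f : F[X]) (hsf : Squarefree f) (hdeg : f.natDegree = 3)
    (n : ℕ) (α β : Fin n → F)
    (hdist : Function.Injective (fun i => (α i, β i)))
    (hcurve : ∀ i, β i ^ 2 = f.eval (α i))
    (k : ℕ) (hk : Even k) (hk4 : 4 ≤ k) (hkn : k ≤ n - 2)
    (ℓ : ℕ) (hℓ : ℓ ≤ k / 2) (η : F) (hη : η ≠ 0)
    (e : Fin (k / 2 + 1) ⊕ Fin ((k - 4) / 2 + 1) → Fin n → F)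
    (he : e = Sum.elim
      (fun (a : Fin (k / 2 + 1)) => fun i => α i ^ (a : ℕ) +
        if (a : ℕ) = ℓ then η * α i ^ ((k - 2) / 2) * β i else 0)
      (fun (b : Fin ((k - 4) / 2 + 1)) => fun i => α i ^ (b : ℕ) * β i)) :
    LinearIndependent F e ∧
      Module.finrank F ↥(Submodule.span F (Set.range e)) = k := by
  have hli : LinearIndependent F e := by
    rw [Fintype.linearIndependent_iff]
    intro g hg
    let L : Fin (k / 2 + 1) := ⟨ℓ, by omega⟩
    set c : F[X] := ∑ a : Fin (k / 2 + 1), C (g (Sum.inl a)) * X ^ (a : ℕ) with hc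
    set d₀ : F[X] := ∑ b : Fin ((k - 4) / 2 + 1), C (g (Sum.inr b)) * X ^ (b : ℕ) with hd₀
    set d : F[X] := d₀ + C (g (Sum.inl L) * η) * X ^ ((k - 2) / 2) with hd
    have hcdeg : c.natDegree ≤ k / 2 := natDegree_sum_fin_C_mul_X_pow_le _
    have hd₀deg : d₀.natDegree ≤ (k - 4) / 2 := natDegree_sum_fin_C_mul_X_pow_le _
    have hddeg : d.natDegree ≤ (k - 2) / 2 :=
      natDegree_add_le_of_degree_le (by omega) (natDegree_C_mul_X_pow_le _ _)
    have hzero : ∀ i, c.eval (α i) + d.eval (α i) * β i = 0 := by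
      intro i
      have hi := congrFun hg i
      have hL : ∀ a : Fin (k / 2 + 1), (a : ℕ) = ℓ ↔ a = L := fun a => by simp [L, Fin.ext_iff]
      simp only [he, Fintype.sum_sum_type, Sum.elim_inl, Sum.elim_inr,
        Finset.sum_apply, Pi.smul_apply, smul_eq_mul, Pi.zero_apply, mul_add,
        Finset.sum_add_distrib, hL, mul_ite, mul_zero, Finset.sum_ite_eq', Finset.mem_univ,
        if_true] at hi
      simp only [hc, hd, hd₀, eval_add, eval_finsetSum, eval_mul, eval_C, eval_pow, eval_X,
        add_mul, Finset.sum_mul]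
      simp only [← mul_assoc] at hi ⊢
      linear_combination hi
    obtain ⟨hc0, hd0⟩ := eq_zero_of_many_zeros hdeg α β hdist hcurve hzero
      (by rw [Fintype.card_fin]; omega) (by rw [Fintype.card_fin]; omega)
    have hinl : ∀ a, g (Sum.inl a) = 0 := fun a => by
      rw [← coeff_sum_fin_C_mul_X_pow (fun a => g (Sum.inl a)) a, ← hc, hc0, coeff_zero]
    have hd₀0 : d₀ = 0 := by simpa [hd, hinl L] using hd0
    rintro (a | b)
    · exact hinl a
    · rw [← coeff_sum_fin_C_mul_X_pow (fun b => g (Sum.inr b)) b, ← hd₀, hd₀0, coeff_zero]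
  refine ⟨hli, ?_⟩
  rw [finrank_span_eq_card hli, Fintype.card_sum, Fintype.card_fin, Fintype.card_fin]
  obtain ⟨m, hm⟩ := hk
  omega
end

section
/- Let q be a power of an odd prime, f ∈ 𝔽_q[X] square-free of degree 3, and let D consist of n pairwise distinct affine points P_i = (α_i, β_i) of y² = f(x) with β_i ≠ 0 for all i, where n = 2s is even. Let k be odd with 3 ≤ k ≤ n−3, η ∈ 𝔽_q^*, v ∈ (𝔽_q^*)^n, and let γ ∈ (𝔽_q^*)^n satisfy the first-type residue relations for D. Set A = Σ_{i=1}^n γ_i α_i^{s−1} and B = Σ_{i=1}^n γ_i α_i^{s+1}/β_i, and assume (A, B) ≠ (0, 0). Put f₁(x, y) = ηA·x^{s−(k−1)/2} − (A + ηB)·x^{s−(k+3)/2}·y. Then the dual code C(D, kO, (k−3)/2, η, v)^⊥ of the twisted generalized elliptic curve code equals the 𝔽_q-span of the n−k vectors (γ_i·f₁(α_i, β_i)/(v_i·β_i))_{i=1}^n, (γ_i·α_i^a/(v_i·β_i))_{i=1}^n for 0 ≤ a ≤ (n−k−1)/2, and (γ_i·α_i^b/v_i)_{i=1}^n for 0 ≤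 b ≤ (n−k−5)/2. -/
open Polynomial

/-- A polynomial function `c(x) + d(x) y` on `y² = f(x)`, `deg f = 3`, whose pole order is smaller
than the number of points at which it vanishes is zero. -/
theorem eq_zero_of_vanish_on_curve {F : Type*} [Field F] (hchar : ringChar F ≠ 2)
    {f : F[X]} (hdeg : f.natDegree = 3) {n : ℕ} {α β : Fin n → F}
    (hdist : Function.Injective (fun i => (α i, β i))) (hβ0 : ∀ i, β i ≠ 0)
    (hcurve : ∀ i, β i ^ 2 = f.eval (α i)) {c d : F[X]}
    (hc : 2 * c.natDegree < n) (hd : 2 * d.natDegree + 3 < n)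
    (h : ∀ i, c.eval (α i) + d.eval (α i) * β i = 0) : c = 0 ∧ d = 0 := by
  classical
  have hf0 : f ≠ 0 := by
    rintro rfl
    simp at hdeg
  have h2 : (2 : F) ≠ 0 := Ring.two_ne_zero hchar
  have hdegN : (c ^ 2 - d ^ 2 * f).natDegree < n := by
    refine (natDegree_sub_le _ _).trans_lt (max_lt ?_ ?_)
    · rwa [natDegree_pow]
    · refine natDegree_mul_le.trans_lt ?_
      rwa [natDegree_pow, hdeg]
  have hN : c ^ 2 - d ^ 2 * f = 0 := by
    by_contra hN
    have hle : Finset.univ.val.map α ≤ (c ^ 2 - d ^ 2 * f).roots := by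
      rw [Multiset.le_iff_count]
      intro a
      rw [Multiset.count_map, count_roots, ← Finset.filter_val, Finset.card_val]
      set S := Finset.univ.filter fun i => a = α i with hS
      have hmem : ∀ i ∈ S, α i = a := fun i hi => (Finset.mem_filter.1 hi).2.symm
      rcases Nat.lt_or_ge 1 S.card with hlt | hle
      · obtain ⟨i, hi, j, hj, hij⟩ := Finset.one_lt_card.1 hlt
        have hopp : ∀ i ∈ S, ∀ j ∈ S, i ≠ j → β j = - β i := by
          intro i hi j hj hij
          have hsq : β j ^ 2 = β i ^ 2 := by
            rw [hcurve, hcurve, hmem i hi, hmem j hj]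
          rcases sq_eq_sq_iff_eq_or_eq_neg.1 hsq with hh | hh
          · exact absurd (hdist (Prod.ext ((hmem i hi).trans (hmem j hj).symm) hh.symm)) hij
          · exact hh
        have hcard : S.card ≤ 2 := by
          by_contra! hgt
          obtain ⟨x, y, z, hx, hy, hz, hxy, hxz, hyz⟩ := Finset.two_lt_card_iff.1 hgt
          have e1 := hopp x hx y hy hxy
          have e2 := hopp x hx z hz hxz
          have e3 := hopp y hy z hz hyz
          have : 2 * β x = 0 := by rw [e1] at e3; linear_combination e2 - e3
          exact (mul_ne_zero h2 (hβ0 x)) this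
        refine hcard.trans ((le_rootMultiplicity_iff hN).2 ?_)
        have e1 := h i
        have e2 := h j
        rw [hmem i hi] at e1
        rw [hmem j hj, hopp i hi j hj hij] at e2
        have hca : c.eval a = 0 := by
          have : 2 * c.eval a = 0 := by linear_combination e1 + e2
          exact (mul_eq_zero.1 this).resolve_left h2
        have hda : d.eval a = 0 := by
          rw [hca, zero_add] at e1
          exact (mul_eq_zero.1 e1).resolve_right (hβ0 i)
        exact dvd_sub (pow_dvd_pow_of_dvd (dvd_iff_isRoot.2 hca) 2)
          ((pow_dvd_pow_of_dvd (dvd_iff_isRoot.2 hda) 2).mul_right f)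
      · rcases S.eq_empty_or_nonempty with he | ⟨i, hi⟩
        · simp [he]
        · refine hle.trans ((rootMultiplicity_pos hN).2 ?_)
          rw [← hmem i hi, IsRoot.def]
          simp only [eval_sub, eval_mul, eval_pow, ← hcurve]
          linear_combination (c.eval (α i) - d.eval (α i) * β i) * h i
    have := (Multiset.card_le_card hle).trans (card_roots' _)
    simp at this
    omega
  have hd0 : d = 0 := by
    by_contra hd0
    have := congrArg natDegree (sub_eq_zero.1 hN)
    rw [natDegree_mul (pow_ne_zero 2 hd0) hf0, natDegree_pow, natDegree_pow, hdeg] at this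
    omega
  refine ⟨?_, hd0⟩
  simpa [hd0] using hN

theorem coeff_sum_fin_C_mul_X_pow_s6 {R : Type*} [Semiring R] {N : ℕ} (g : Fin N → R) (j : ℕ) :
    (∑ a, C (g a) * X ^ (a : ℕ)).coeff j = if h : j < N then g ⟨j, h⟩ else 0 := by
  simp only [finsetSum_coeff, coeff_C_mul_X_pow]
  split_ifs with h
  · rw [Finset.sum_eq_single ⟨j, h⟩]
    · simp
    · intro b _ hb
      rw [if_neg]
      rintro rfl
      exact hb rfl
    · simp
  · refine Finset.sum_eq_zero fun b _ => if_neg ?_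
    have := b.2
    omega

theorem eq_zero_of_sum_fin_C_mul_X_pow {R : Type*} [Semiring R] {N : ℕ} {g : Fin N → R}
    (h : ∑ a, C (g a) * X ^ (a : ℕ) = 0) (a : Fin N) : g a = 0 := by
  have := coeff_sum_fin_C_mul_X_pow_s6 g a
  simpa [h] using this.symm

theorem natDegree_sum_fin_C_mul_X_pow_le_s6 {R : Type*} [Semiring R] {N M : ℕ} (hN : N ≤ M + 1)
    (g : Fin N → R) : (∑ a, C (g a) * X ^ (a : ℕ)).natDegree ≤ M := by
  refine natDegree_sum_le_of_forall_le _ _ fun a _ => (natDegree_C_mul_X_pow_le _ _).trans ?_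
  have := a.2
  omega

/-- Two independent, mutually orthogonal families of complementary sizes span dual codes. -/
theorem dual_span_eq_span_of_card {F ι κ : Type*} [Field F] [Fintype ι] [Fintype κ] {n : ℕ}
    {u : ι → Fin n → F} {w : κ → Fin n → F} (hu : LinearIndependent F u)
    (hw : LinearIndependent F w) (hcard : Fintype.card ι + Fintype.card κ = n)
    (horth : ∀ a b, ∑ i, w b i * u a i = 0) :
    {x : Fin n → F | ∀ c ∈ Submodule.span F (Set.range u), ∑ i, x i * c i = 0} =
      (Submodule.span F (Set.range w) : Set (Fin n → F)) := by
  have hker : {x : Fin n → F | ∀ c ∈ Submodule.span F (Set.range u), ∑ i, x i * c i = 0} =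
      (LinearMap.ker (Matrix.of u).mulVecLin : Set (Fin n → F)) := by
    ext x
    simp only [Set.mem_ofPred_eq, SetLike.mem_coe, LinearMap.mem_ker, Matrix.mulVecLin_apply]
    constructor
    · intro h
      ext a
      rw [Matrix.mulVec, dotProduct_comm]
      exact h _ (Submodule.subset_span ⟨a, rfl⟩)
    · intro h c hc
      induction hc using Submodule.span_induction with
      | mem c hc =>
        obtain ⟨a, rfl⟩ := hc
        have := congrFun h a
        rwa [Matrix.mulVec, dotProduct_comm] at this
      | zero => simp
      | add c d _ _ hc hd => simp [mul_add, Finset.sum_add_distrib, hc, hd]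
      | smul r c _ hc => simp [mul_left_comm _ r, ← Finset.mul_sum, hc]
  rw [hker]
  congr 1
  symm
  apply Submodule.eq_of_le_of_finrank_eq
  · rw [Submodule.span_le]
    rintro _ ⟨b, rfl⟩
    simp only [SetLike.mem_coe, LinearMap.mem_ker, Matrix.mulVecLin_apply]
    ext a
    rw [Matrix.mulVec, dotProduct_comm]
    exact horth a b
  · rw [finrank_span_eq_card hw]
    have h1 := (Matrix.of u).mulVecLin.finrank_range_add_finrank_ker
    have h2 : Module.finrank F (LinearMap.range (Matrix.of u).mulVecLin) = Fintype.card ι :=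
      LinearIndependent.rank_matrix (M := Matrix.of u) hu
    simp only [Module.finrank_fintype_fun_eq_card, Fintype.card_fin] at h1
    omega

theorem stmt_6 (F : Type*) [Field F] [Fintype F] (hchar : ringChar F ≠ 2)
    (f : F[X]) (hsf : Squarefree f) (hdeg : f.natDegree = 3)
    (n s : ℕ) (hn : n = 2 * s)
    (α β : Fin n → F)
    (hdist : Function.Injective (fun i => (α i, β i)))
    (hβ0 : ∀ i, β i ≠ 0)
    (hcurve : ∀ i, β i ^ 2 = f.eval (α i))
    (k : ℕ) (hk : Odd k) (hk3 : 3 ≤ k) (hkn : k ≤ n - 3)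
    (η : F) (hη : η ≠ 0)
    (v γ : Fin n → F) (hv : ∀ i, v i ≠ 0) (hγ : ∀ i, γ i ≠ 0)
    (hres1 : ∀ j : ℕ, 2 * j ≤ n → ∑ i, γ i * α i ^ j / β i = 0)
    (hres2 : ∀ j : ℕ, 2 * j ≤ n - 4 → ∑ i, γ i * α i ^ j = 0)
    (hres3 : ∀ j : ℕ, 2 * j ≤ n - 6 → ∑ i, γ i * α i ^ j * β i = 0)
    (A B : F)
    (hA : A = ∑ i, γ i * α i ^ (s - 1))
    (hB : B = ∑ i, γ i * α i ^ (s + 1) / β i)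
    (hAB : ¬(A = 0 ∧ B = 0))
    (C : Submodule F (Fin n → F))
    (hC : C = Submodule.span F (Set.range (Sum.elim
      (fun (a : Fin ((k - 1) / 2 + 1)) => fun i => v i * α i ^ (a : ℕ))
      (fun (b : Fin ((k - 3) / 2 + 1)) => fun i => v i * (α i ^ (b : ℕ) * β i +
        if (b : ℕ) = (k - 3) / 2 then η * α i ^ ((k + 1) / 2) else 0)))))
    (H : Submodule F (Fin n → F))
    (hH : H = Submodule.span F (Set.range (Sum.elim
      (fun (_ : Fin 1) => fun i => γ i * (η * A * α i ^ (s - (k - 1) / 2)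
        - (A + η * B) * α i ^ (s - (k + 3) / 2) * β i) / (v i * β i))
      (Sum.elim
        (fun (a : Fin ((n - k - 1) / 2 + 1)) => fun i => γ i * α i ^ (a : ℕ) / (v i * β i))
        (fun (b : Fin ((n - k - 3) / 2)) => fun i => γ i * α i ^ (b : ℕ) / v i))))) :
    {u : Fin n → F | ∀ c ∈ C, ∑ i, u i * c i = 0} = (H : Set (Fin n → F)) := by
  classical
  obtain ⟨m, hm⟩ := hk
  obtain ⟨l, rfl⟩ : ∃ l, m = l + 1 := ⟨m - 1, by omega⟩
  obtain ⟨t, rfl⟩ : ∃ t, s = l + t + 3 := ⟨s - l - 3, by omega⟩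
  have e1 : (k - 1) / 2 = l + 1 := by omega
  have e2 : (k - 3) / 2 = l := by omega
  have e3 : (k + 1) / 2 = l + 2 := by omega
  have e4 : (k + 3) / 2 = l + 3 := by omega
  have e5 : (n - k - 1) / 2 = t + 1 := by omega
  have e6 : (n - k - 3) / 2 = t := by omega
  have e7 : l + t + 3 - (l + 1) = t + 2 := by omega
  have e8 : l + t + 3 - (l + 3) = t := by omega
  rw [e1, e2, e3] at hC
  rw [e1, e4, e5, e6, e7, e8] at hH
  rw [hC, hH]
  apply dual_span_eq_span_of_card
  · rw [Fintype.linearIndependent_iff]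
    intro g hg
    obtain ⟨hc, hd⟩ := eq_zero_of_vanish_on_curve hchar hdeg hdist hβ0 hcurve
      (c := ∑ a, Polynomial.C (g (Sum.inl a)) * X ^ (a : ℕ)
        + ∑ b, Polynomial.C (g (Sum.inr b)) *
          (if (b : ℕ) = l then Polynomial.C η * X ^ (l + 2) else 0))
      (d := ∑ b, Polynomial.C (g (Sum.inr b)) * X ^ (b : ℕ))
      (by
        suffices h : natDegree _ ≤ l + 2 by
          refine (Nat.mul_le_mul_left 2 h).trans_lt ?_
          omega
        refine natDegree_add_le_of_degree_le
          (natDegree_sum_fin_C_mul_X_pow_le_s6 (by omega) _)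
          (natDegree_sum_le_of_forall_le _ _ fun b _ => (natDegree_C_mul_le _ _).trans ?_)
        split_ifs
        · exact natDegree_C_mul_X_pow_le _ _
        · simp)
      (by
        have := natDegree_sum_fin_C_mul_X_pow_le_s6 le_rfl (fun b => g (Sum.inr b))
        omega)
      (by
        intro i
        have := congrFun hg i
        simp only [Fintype.sum_sum_type, Sum.elim_inl, Sum.elim_inr,
          Finset.sum_apply, Pi.smul_apply, smul_eq_mul, Pi.zero_apply] at this
        apply (mul_eq_zero.1 (?_ : v i * _ = 0)).resolve_left (hv i)
        rw [← this]
        simp only [eval_add, eval_finsetSum, eval_mul, eval_C, eval_pow, eval_X,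
          apply_ite (eval (α i)), eval_zero, mul_add, Finset.mul_sum, Finset.sum_mul,
          Finset.sum_add_distrib]
        rw [add_assoc, add_comm (∑ b, v i * (g (Sum.inr b) * ite _ _ _))]
        refine congrArg₂ _ ?_ (congrArg₂ _ ?_ ?_) <;>
          exact Finset.sum_congr rfl fun _ _ => by ring)
    have hr := eq_zero_of_sum_fin_C_mul_X_pow hd
    simp only [hr, C_0, zero_mul, Finset.sum_const_zero, add_zero] at hc
    rintro (a | b)
    · exact eq_zero_of_sum_fin_C_mul_X_pow hc a
    · exact hr b
  · rw [Fintype.linearIndependent_iff]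
    intro g hg
    obtain ⟨hc, hd⟩ := eq_zero_of_vanish_on_curve hchar hdeg hdist hβ0 hcurve
      (c := Polynomial.C (g (Sum.inl 0) * (η * A)) * X ^ (t + 2)
        + ∑ a, Polynomial.C (g (Sum.inr (Sum.inl a))) * X ^ (a : ℕ))
      (d := Polynomial.C (g (Sum.inl 0) * -(A + η * B)) * X ^ t
        + ∑ b, Polynomial.C (g (Sum.inr (Sum.inr b))) * X ^ (b : ℕ))
      (by
        suffices h : natDegree _ ≤ t + 2 by
          refine (Nat.mul_le_mul_left 2 h).trans_lt ?_
          omega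
        exact natDegree_add_le_of_degree_le (natDegree_C_mul_X_pow_le _ _)
          (natDegree_sum_fin_C_mul_X_pow_le_s6 (by omega) _))
      (by
        suffices h : natDegree _ ≤ t by
          refine (Nat.add_le_add_right (Nat.mul_le_mul_left 2 h) 3).trans_lt ?_
          omega
        exact natDegree_add_le_of_degree_le (natDegree_C_mul_X_pow_le _ _)
          (natDegree_sum_fin_C_mul_X_pow_le_s6 (by omega) _))
      (by
        intro i
        have := congrFun hg i
        simp only [Fintype.sum_sum_type, Sum.elim_inl, Sum.elim_inr,
          Finset.sum_apply, Pi.smul_apply, smul_eq_mul, Pi.zero_apply, Finset.univ_unique,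
          Finset.sum_singleton, Fin.default_eq_zero] at this
        have hne : γ i / (v i * β i) ≠ 0 := div_ne_zero (hγ i) (mul_ne_zero (hv i) (hβ0 i))
        apply (mul_eq_zero.1 (?_ : γ i / (v i * β i) * _ = 0)).resolve_left hne
        rw [← this]
        simp only [eval_add, eval_finsetSum, eval_mul, eval_C, eval_pow, eval_X, mul_add,
          add_mul, Finset.mul_sum, Finset.sum_mul]
        have h1 : ∀ a : Fin (t + 1 + 1),
            γ i / (v i * β i) * (g (Sum.inr (Sum.inl a)) * α i ^ (a : ℕ)) =
              g (Sum.inr (Sum.inl a)) * (γ i * α i ^ (a : ℕ) / (v i * β i)) :=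
          fun a => by ring
        have h2 : ∀ b : Fin t,
            γ i / (v i * β i) * (g (Sum.inr (Sum.inr b)) * α i ^ (b : ℕ) * β i) =
              g (Sum.inr (Sum.inr b)) * (γ i * α i ^ (b : ℕ) / v i) := by
          intro b
          have := hv i
          have := hβ0 i
          field_simp
        simp only [h1, h2]
        ring)
    have h1 := congrArg (coeff · (t + 2)) hc
    have h2 := congrArg (coeff · t) hd
    simp only [coeff_add, coeff_C_mul_X_pow, coeff_sum_fin_C_mul_X_pow_s6] at h1 h2
    simp only [if_true, lt_irrefl, dite_false, coeff_zero, add_zero] at h1 h2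
    have hg0 : g (Sum.inl 0) = 0 := by
      by_contra h0
      have hA0 : A = 0 := by simpa [h0, hη] using h1
      exact hAB ⟨hA0, by simpa [h0, hη, hA0] using h2⟩
    simp only [hg0, zero_mul, C_0, zero_add] at hc hd
    rintro (a | a | b)
    · rwa [Subsingleton.elim a 0]
    · exact eq_zero_of_sum_fin_C_mul_X_pow hc a
    · exact eq_zero_of_sum_fin_C_mul_X_pow hd b
  · simp only [Fintype.card_sum, Fintype.card_fin]
    omega
  · rw [show l + t + 3 - 1 = l + t + 2 by omega] at hA
    rintro (a | b) (c | c | c)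
    · have ha := a.2
      have h1 := hres1 (t + 2 + a) (by omega)
      have h2 := hres2 (t + a) (by omega)
      calc _ = η * A * ∑ i, γ i * α i ^ (t + 2 + a) / β i
            - (A + η * B) * ∑ i, γ i * α i ^ (t + a) := by
            rw [Finset.mul_sum, Finset.mul_sum, ← Finset.sum_sub_distrib]
            refine Finset.sum_congr rfl fun i _ => ?_
            have := hv i
            have := hβ0 i
            simp only [Sum.elim_inl]
            field_simp
            ring
        _ = 0 := by rw [h1, h2]; ring
    · have ha := a.2
      have hc := c.2
      rw [← hres1 (c + a) (by omega)]
      refine Finset.sum_congr rfl fun i _ => ?_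
      have := hv i
      have := hβ0 i
      simp only [Sum.elim_inl, Sum.elim_inr]
      field_simp
      ring
    · have ha := a.2
      have hc := c.2
      rw [← hres2 (c + a) (by omega)]
      refine Finset.sum_congr rfl fun i _ => ?_
      have := hv i
      simp only [Sum.elim_inl, Sum.elim_inr]
      field_simp
      ring
    · have hb := b.2
      have h3 := hres3 (t + b) (by omega)
      by_cases hbl : (b : ℕ) = l
      · rw [hbl] at h3
        calc _ = η * A * (∑ i, γ i * α i ^ (l + t + 2)
                + η * ∑ i, γ i * α i ^ (l + t + 3 + 1) / β i)
              - (A + η * B) * (∑ i, γ i * α i ^ (t + l) * β i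
                + η * ∑ i, γ i * α i ^ (l + t + 2)) := by
              simp only [Finset.mul_sum, ← Finset.sum_add_distrib, ← Finset.sum_sub_distrib]
              refine Finset.sum_congr rfl fun i _ => ?_
              have := hv i
              have := hβ0 i
              simp only [Sum.elim_inl, Sum.elim_inr, hbl, if_true]
              field_simp
              ring
          _ = 0 := by rw [h3, ← hA, ← hB]; ring
      · have h2 := hres2 (t + 2 + b) (by omega)
        calc _ = η * A * ∑ i, γ i * α i ^ (t + 2 + b)
              - (A + η * B) * ∑ i, γ i * α i ^ (t + b) * β i := by
              simp only [Finset.mul_sum, ← Finset.sum_sub_distrib]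
              refine Finset.sum_congr rfl fun i _ => ?_
              have := hv i
              have := hβ0 i
              simp only [Sum.elim_inl, Sum.elim_inr, hbl, if_false]
              field_simp
              ring
          _ = 0 := by rw [h2, h3]; ring
    · have hb := b.2
      have hc := c.2
      have h2 := hres2 (c + b) (by omega)
      have h1 := hres1 (c + (l + 2)) (by omega)
      calc _ = ∑ i, γ i * α i ^ (c + b : ℕ)
            + (if (b : ℕ) = l then η else 0) * ∑ i, γ i * α i ^ (c + (l + 2)) / β i := by
            simp only [Finset.mul_sum, ← Finset.sum_add_distrib]
            refine Finset.sum_congr rfl fun i _ => ?_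
            have := hv i
            have := hβ0 i
            simp only [Sum.elim_inl, Sum.elim_inr]
            split_ifs <;> field_simp <;> ring
        _ = 0 := by rw [h1, h2]; ring
    · have hb := b.2
      have hc := c.2
      have h3 := hres3 (c + b) (by omega)
      have h2 := hres2 (c + (l + 2)) (by omega)
      calc _ = ∑ i, γ i * α i ^ (c + b : ℕ) * β i
            + (if (b : ℕ) = l then η else 0) * ∑ i, γ i * α i ^ (c + (l + 2)) := by
            simp only [Finset.mul_sum, ← Finset.sum_add_distrib]
            refine Finset.sum_congr rfl fun i _ => ?_
            have := hv i
            simp only [Sum.elim_inr]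
            split_ifs <;> field_simp <;> ring
        _ = 0 := by rw [h2, h3]; ring
end

section
/- Let q be a power of an odd prime, f ∈ 𝔽_q[X] square-free of degree 3, k odd with k ≥ 3, and n = 2k. Let the n points of D be P_{2m−1} = (α_m, β_m) and P_{2m} = (α_m, −β_m) for m = 1, …, k, where α_1, …, α_k ∈ 𝔽_q are pairwise distinct and β_m ≠ 0 satisfies β_m² = f(α_m); write (α_i, β_i) for the coordinates of P_i, i = 1, …, n. Let η ∈ 𝔽_q^* and γ, v ∈ (𝔽_q^*)^n. Set A = Σ_{i=1}^n γ_i α_i^{k−1}, B = Σ_{i=1}^n γ_i α_i^{k+1}/β_i, and f₁(x, y) = ηA·x^{(k+1)/2} − (A + ηB)·x^{(k−3)/2}·y. Define the k 'generator' vectors g_a = (v_i α_i^a)_i for 0 ≤ a ≤ (k−1)/2, g'_b = (v_i β_i α_i^b)_i for 0 ≤ b ≤ (k−5)/2, and g* = (v_i(β_i α_i^{(k−3)/2} + η α_i^{(k+1)/2}))_i, and the k 'parity-check' vectors h₀ = (γ_i f₁(α_i, β_i)/(v_i β_i))_i, p_a = (γ_i α_i^a/(v_i β_i))_i for 0 ≤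 a ≤ (k−1)/2, and q_b = (γ_i α_i^b/v_i)_i for 0 ≤ b ≤ (k−5)/2. Then Span{g_a, g'_b, g*} = Span{h₀, p_a, q_b} if and only if both: (1) Span{g_a (0 ≤ a ≤ (k−1)/2), g'_b (0 ≤ b ≤ (k−5)/2)} = Span{p_a (0 ≤ a ≤ (k−1)/2), q_b (0 ≤ b ≤ (k−5)/2)}, and (2) g* = a·h₀ for some a ∈ 𝔽_q^*. -/
open Polynomial

section EvaluationPairs

variable {F ι : Type*} [Field F]

/-- The vector `(v i * (P (α i) + Q (α i) * β i))` attached to the function `P(x) + Q(x) y`. -/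
noncomputable def evalPair (v α β : ι → F) : F[X] × F[X] →ₗ[F] (ι → F) where
  toFun PQ i := v i * (PQ.1.eval (α i) + PQ.2.eval (α i) * β i)
  map_add' x y := by ext i; simp; ring
  map_smul' c x := by ext i; simp; ring

theorem evalPair_apply (v α β : ι → F) (P Q : F[X]) (i : ι) :
    evalPair v α β (P, Q) i = v i * (P.eval (α i) + Q.eval (α i) * β i) := rfl

theorem mem_span_insert_monomials {v α β : ι → F} {r s : ℕ} {g : Fin r ⊕ Fin s → ι → F}
    (hg : g = Sum.elim (fun (a : Fin r) i => v i * α i ^ (a : ℕ))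
      (fun (b : Fin s) i => v i * β i * α i ^ (b : ℕ)))
    {u x : ι → F} (hx : x ∈ Submodule.span F (insert u (Set.range g))) :
    ∃ (t : F) (P Q : F[X]), P.degree < r ∧ Q.degree < s ∧ x = t • u + evalPair v α β (P, Q) := by
  obtain ⟨t, z, hz, rfl⟩ := Submodule.mem_span_insert.1 hx
  have hle : Submodule.span F (Set.range g) ≤
      ((degreeLT F r).prod (degreeLT F s)).map (evalPair v α β) := by
    rw [Submodule.span_le]
    rintro _ ⟨a | b, rfl⟩
    · refine ⟨(X ^ (a : ℕ), 0), ⟨?_, by simp⟩, ?_⟩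
      · simp [mem_degreeLT]
      · ext i
        simp [hg, evalPair_apply]
    · refine ⟨(0, X ^ (b : ℕ)), ⟨by simp, ?_⟩, ?_⟩
      · simp [mem_degreeLT]
      · ext i
        simp [hg, evalPair_apply]
        ring
  obtain ⟨⟨P, Q⟩, ⟨hP, hQ⟩, rfl⟩ := hle hz
  exact ⟨t, P, Q, mem_degreeLT.1 hP, mem_degreeLT.1 hQ, rfl⟩

theorem coeff_eq_zero_of_X_pow_mul_eq {P R : F[X]} {n d j : ℕ} (h : X ^ n * P = R)
    (hR : R.degree < d) (hj : d ≤ j + n) : P.coeff j = 0 := by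
  rw [← coeff_X_pow_mul P n j, h]
  exact coeff_eq_zero_of_degree_lt (hR.trans_le (by exact_mod_cast hj))

theorem eq_of_eval_eq_of_degree_lt {k d : ℕ} {a : Fin k → F} (ha : Function.Injective a)
    {P R : F[X]} (hd : d ≤ k) (hP : P.degree < d) (hR : R.degree < d)
    (h : ∀ m, P.eval (a m) = R.eval (a m)) : P = R := by
  have hdk : (d : WithBot ℕ) ≤ ((Finset.univ : Finset (Fin k)).card : ℕ) := by simpa using hd
  exact eq_of_degrees_lt_of_eval_index_eq Finset.univ (ha.injOn)
    (hP.trans_le hdk) (hR.trans_le hdk) fun i _ => h i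

theorem degree_add_C_mul_X_pow_lt {P : F[X]} {n d : ℕ} (c : F) (hP : P.degree < d)
    (hd : d ≤ n + 1) : (P + C c * X ^ n).degree < ((n + 1 : ℕ) : WithBot ℕ) :=
  (degree_add_le _ _).trans_lt (max_lt (hP.trans_le (by exact_mod_cast hd))
    ((degree_C_mul_X_pow_le n c).trans_lt (by exact_mod_cast n.lt_succ_self)))

theorem degree_X_pow_mul_lt {P : F[X]} {n d e : ℕ} (hP : P.degree < d) (h : n + d ≤ e) :
    (X ^ n * P).degree < (e : WithBot ℕ) := by
  rw [degree_mul, degree_X_pow]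
  by_cases h0 : P = 0
  · simp [h0]
  rw [degree_eq_natDegree h0] at hP ⊢
  norm_cast at hP ⊢
  omega

/-- If a function `w` and its multiple `w x ^ (m + 1)` both agree with elements of
`⟨x ^ a, x ^ b y, x ^ m y + η x ^ (m + 2) : a < m + 2, b < m⟩`, then `w` is constant. -/
theorem eq_const_of_monomial_multiples {m : ℕ} {a : Fin (2 * m + 3) → F}
    (ha : Function.Injective a) {η t₀ t₁ : F} {P₀ Q₀ P₁ Q₁ : F[X]}
    (hP₀ : P₀.degree < (m + 2 : ℕ)) (hQ₀ : Q₀.degree < m)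
    (hP₁ : P₁.degree < (m + 2 : ℕ)) (hQ₁ : Q₁.degree < m)
    (hP : ∀ i, (X ^ (m + 1) * (P₀ + C (t₀ * η) * X ^ (m + 2))).eval (a i) =
      (P₁ + C (t₁ * η) * X ^ (m + 2)).eval (a i))
    (hQ : ∀ i, (X ^ (m + 1) * (Q₀ + C t₀ * X ^ m)).eval (a i) =
      (Q₁ + C t₁ * X ^ m).eval (a i)) :
    ∃ c, P₀ + C (t₀ * η) * X ^ (m + 2) = C c ∧ Q₀ + C t₀ * X ^ m = 0 := by
  have dQ₀ := degree_add_C_mul_X_pow_lt t₀ hQ₀ m.le_succ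
  have dQ₁ := degree_add_C_mul_X_pow_lt t₁ hQ₁ m.le_succ
  have eQ := eq_of_eval_eq_of_degree_lt ha (d := 2 * m + 3) le_rfl
    (degree_X_pow_mul_lt dQ₀ (by omega)) (dQ₁.trans_le (by norm_cast; omega)) hQ
  have zQ₀ : Q₀ + C t₀ * X ^ m = 0 := by
    ext j
    exact coeff_eq_zero_of_X_pow_mul_eq eQ dQ₁ (by omega)
  rw [zQ₀, mul_zero] at eQ
  have ht₀ : t₀ = 0 := by
    simpa [coeff_eq_zero_of_degree_lt hQ₀] using congrArg (fun R => R.coeff m) zQ₀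
  have ht₁ : t₁ = 0 := by
    simpa [coeff_eq_zero_of_degree_lt hQ₁] using (congrArg (fun R => R.coeff m) eQ).symm
  simp only [ht₀, ht₁, zero_mul, C_0, add_zero] at hP
  have eP := eq_of_eval_eq_of_degree_lt ha (d := 2 * m + 3) le_rfl
    (degree_X_pow_mul_lt hP₀ (by omega)) (hP₁.trans_le (by norm_cast; omega)) hP
  refine ⟨P₀.coeff 0, ?_, zQ₀⟩
  rw [ht₀, zero_mul, C_0, zero_mul, add_zero]
  refine eq_C_of_degree_le_zero (degree_le_of_natDegree_le ?_)
  rw [natDegree_le_iff_coeff_eq_zero]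
  intro j hj
  exact coeff_eq_zero_of_X_pow_mul_eq eP hP₁ (by omega)

end EvaluationPairs

/-- A function `P(x) + Q(x) y` vanishing at `(a, b)` and `(a, -b)` with `b ≠ 0` has
`P(a) = Q(a) = 0`. -/
theorem eq_and_eq_of_conjugate_eq {F : Type*} [Field F] (h2 : (2 : F) ≠ 0) {b p q r s : F}
    (hb : b ≠ 0) (h₁ : p + q * b = r + s * b) (h₂ : p + q * -b = r + s * -b) :
    p = r ∧ q = s :=
  ⟨mul_left_cancel₀ h2 (by linear_combination h₁ + h₂),
    mul_left_cancel₀ (mul_ne_zero h2 hb) (by linear_combination h₁ - h₂)⟩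

open scoped Pointwise in
theorem span_range_smul {F M κ : Type*} [Field F] [AddCommGroup M] [Module F M] {c : F}
    (hc : c ≠ 0) (g : κ → M) :
    Submodule.span F (Set.range fun j => c • g j) = Submodule.span F (Set.range g) := by
  rw [← Submodule.span_smul_eq_of_isUnit (Set.range g) c (IsUnit.mk0 c hc), ← Set.image_smul,
    ← Set.range_comp]
  rfl

theorem stmt_8 (F : Type*) [Field F] [Fintype F] (hchar : ringChar F ≠ 2)
    (f : F[X]) (hsf : Squarefree f) (hdeg : f.natDegree = 3)
    (k : ℕ) (hk : Odd k) (hk3 : 3 ≤ k)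
    (αp βp : Fin k → F) (hαinj : Function.Injective αp)
    (hβ0 : ∀ m, βp m ≠ 0) (hcurve : ∀ m, βp m ^ 2 = f.eval (αp m))
    (α β : Fin (2 * k) → F)
    (hα : ∀ m : Fin k, α ⟨2 * m.val, by have := m.isLt; omega⟩ = αp m ∧
          α ⟨2 * m.val + 1, by have := m.isLt; omega⟩ = αp m)
    (hβ : ∀ m : Fin k, β ⟨2 * m.val, by have := m.isLt; omega⟩ = βp m ∧
          β ⟨2 * m.val + 1, by have := m.isLt; omega⟩ = -βp m)
    (η : F) (hη : η ≠ 0)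
    (γ v : Fin (2 * k) → F) (hγ : ∀ i, γ i ≠ 0) (hv : ∀ i, v i ≠ 0)
    (A B : F)
    (hA : A = ∑ i, γ i * α i ^ (k - 1))
    (hB : B = ∑ i, γ i * α i ^ (k + 1) / β i)
    (g : Fin ((k - 1) / 2 + 1) ⊕ Fin ((k - 3) / 2) → Fin (2 * k) → F)
    (hg : g = Sum.elim
      (fun (a : Fin ((k - 1) / 2 + 1)) => fun i => v i * α i ^ (a : ℕ))
      (fun (b : Fin ((k - 3) / 2)) => fun i => v i * β i * α i ^ (b : ℕ)))
    (gstar : Fin (2 * k) → F)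
    (hgstar : gstar = fun i =>
      v i * (β i * α i ^ ((k - 3) / 2) + η * α i ^ ((k + 1) / 2)))
    (p : Fin ((k - 1) / 2 + 1) ⊕ Fin ((k - 3) / 2) → Fin (2 * k) → F)
    (hp : p = Sum.elim
      (fun (a : Fin ((k - 1) / 2 + 1)) => fun i => γ i * α i ^ (a : ℕ) / (v i * β i))
      (fun (b : Fin ((k - 3) / 2)) => fun i => γ i * α i ^ (b : ℕ) / v i))
    (h0 : Fin (2 * k) → F)
    (hh0 : h0 = fun i => γ i * (η * A * α i ^ ((k + 1) / 2)
      - (A + η * B) * α i ^ ((k - 3) / 2) * β i) / (v i * β i)) :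
    Submodule.span F (insert gstar (Set.range g)) =
        Submodule.span F (insert h0 (Set.range p)) ↔
      (Submodule.span F (Set.range g) = Submodule.span F (Set.range p) ∧
        ∃ a : F, a ≠ 0 ∧ gstar = a • h0) := by
  have h2 : (2 : F) ≠ 0 := Ring.two_ne_zero hchar
  obtain ⟨m, rfl⟩ : ∃ m, k = 2 * m + 3 := by
    obtain ⟨j, rfl⟩ := hk
    exact ⟨j - 1, by omega⟩
  have hr : (2 * m + 3 - 1) / 2 + 1 = m + 2 := by omega
  have hs : (2 * m + 3 - 3) / 2 = m := by omega
  have hu : (2 * m + 3 + 1) / 2 = m + 2 := by omega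
  rw [hs, hu] at hgstar hh0
  have hβi : ∀ i, β i ≠ 0 := by
    intro i
    obtain ⟨j, hj | hj⟩ := Nat.even_or_odd' i.val
    · rw [show i = ⟨2 * j, by omega⟩ from Fin.ext hj, (hβ ⟨j, by omega⟩).1]
      exact hβ0 _
    · rw [show i = ⟨2 * j + 1, by omega⟩ from Fin.ext hj, (hβ ⟨j, by omega⟩).2]
      exact neg_ne_zero.2 (hβ0 _)
  have hpair : ∀ P Q R S : F[X],
      (∀ i, P.eval (α i) + Q.eval (α i) * β i = R.eval (α i) + S.eval (α i) * β i) →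
      ∀ j, P.eval (αp j) = R.eval (αp j) ∧ Q.eval (αp j) = S.eval (αp j) := by
    intro P Q R S h j
    have e₁ := h ⟨2 * j.val, by omega⟩
    have e₂ := h ⟨2 * j.val + 1, by omega⟩
    rw [(hα j).1, (hβ j).1] at e₁
    rw [(hα j).2, (hβ j).2] at e₂
    exact eq_and_eq_of_conjugate_eq h2 (hβ0 j) e₁ e₂
  constructor
  swap
  · rintro ⟨h, a, ha, rfl⟩
    rw [Submodule.span_insert, Submodule.span_insert, h,
      Submodule.span_singleton_smul_eq (IsUnit.mk0 a ha)]
  intro h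
  set w : Fin (2 * (2 * m + 3)) → F := fun i => γ i / (v i ^ 2 * β i) with hw
  have hpw : ∀ j, p j = fun i => w i * g j i := by
    rintro (j | j) <;> ext i <;> simp only [hp, hg, hw, Sum.elim_inl, Sum.elim_inr] <;>
      field_simp [hv i, hβi i]
  have hwne : ∀ i, w i ≠ 0 := fun i =>
    div_ne_zero (hγ i) (mul_ne_zero (pow_ne_zero _ (hv i)) (hβi i))
  have expand : ∀ a : Fin ((2 * m + 3 - 1) / 2 + 1), ∃ (t : F) (P Q : F[X]),
      P.degree < (m + 2 : ℕ) ∧ Q.degree < m ∧ ∀ i, w i * α i ^ (a : ℕ) =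
        (P + C (t * η) * X ^ (m + 2)).eval (α i) + (Q + C t * X ^ m).eval (α i) * β i := by
    intro a
    have hmem : p (Sum.inl a) ∈ Submodule.span F (insert gstar (Set.range g)) :=
      h ▸ Submodule.subset_span (Set.mem_insert_of_mem _ (Set.mem_range_self _))
    obtain ⟨t, P, Q, hP, hQ, e⟩ := mem_span_insert_monomials hg hmem
    refine ⟨t, P, Q, hr ▸ hP, hs ▸ hQ, fun i => mul_left_cancel₀ (hv i) ?_⟩
    have ei := congrFun e i
    simp only [hpw, hg, hgstar, Sum.elim_inl, Pi.add_apply, Pi.smul_apply, smul_eq_mul,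
      evalPair_apply] at ei
    simp only [eval_add, eval_mul, eval_C, eval_pow, eval_X]
    linear_combination ei
  obtain ⟨t₀, P₀, Q₀, hP₀, hQ₀, e₀⟩ := expand ⟨0, by omega⟩
  obtain ⟨t₁, P₁, Q₁, hP₁, hQ₁, e₁⟩ := expand ⟨m + 1, by omega⟩
  simp only [pow_zero, mul_one] at e₀ e₁
  have hmul := hpair (X ^ (m + 1) * (P₀ + C (t₀ * η) * X ^ (m + 2)))
    (X ^ (m + 1) * (Q₀ + C t₀ * X ^ m)) _ _ fun i => by
      rw [← e₁ i, e₀ i, eval_mul, eval_mul (q := Q₀ + C t₀ * X ^ m), eval_pow, eval_X]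
      ring
  obtain ⟨c, hc, hc'⟩ := eq_const_of_monomial_multiples hαinj hP₀ hQ₀ hP₁ hQ₁
    (fun j => (hmul j).1) (fun j => (hmul j).2)
  have hwc : ∀ i, w i = c := fun i => by
    rw [e₀ i, hc, hc', eval_C, eval_zero, zero_mul, add_zero]
  have hc0 : c ≠ 0 := hwc ⟨0, by omega⟩ ▸ hwne _
  have hpg : p = fun j => c • g j := by
    ext j i
    simp [hpw, hwc]
  have hspan : Submodule.span F (Set.range g) = Submodule.span F (Set.range p) := by
    rw [hpg, span_range_smul hc0]
  have hmem : gstar ∈ Submodule.span F (insert h0 (Set.range g)) := by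
    rw [Submodule.span_insert, hspan, ← Submodule.span_insert, ← h]
    exact Submodule.subset_span (Set.mem_insert _ _)
  obtain ⟨s, P, Q, hP, hQ, e⟩ := mem_span_insert_monomials hg hmem
  rw [hr] at hP
  rw [hs] at hQ
  have hh : ∀ i, h0 i = v i * (c * (η * A * α i ^ (m + 2) - (A + η * B) * α i ^ m * β i)) := by
    intro i
    rw [hh0, ← hwc i, hw]
    field_simp [hv i, hβi i]
  have htop := hpair (C η * X ^ (m + 2)) (X ^ m) (P + C (s * c * (η * A)) * X ^ (m + 2))
    (Q + C (-(s * c * (A + η * B))) * X ^ m) fun i => mul_left_cancel₀ (hv i) (by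
      have ei := congrFun e i
      simp only [hgstar, hh, Pi.add_apply, Pi.smul_apply, smul_eq_mul, evalPair_apply] at ei
      simp only [eval_add, eval_mul, eval_C, eval_pow, eval_X]
      linear_combination ei)
  have eP := eq_of_eval_eq_of_degree_lt hαinj (d := m + 2 + 1) (by omega)
    ((degree_C_mul_X_pow_le _ _).trans_lt (by norm_cast; omega))
    (degree_add_C_mul_X_pow_lt _ hP (by omega)) fun j => (htop j).1
  have eQ := eq_of_eval_eq_of_degree_lt hαinj (d := m + 1) (by omega)
    ((degree_X_pow_le _).trans_lt (by norm_cast; omega))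
    (degree_add_C_mul_X_pow_lt _ hQ (by omega)) fun j => (htop j).2
  have zP : P = 0 := by
    ext j
    by_cases hj : j < m + 2
    · simpa only [coeff_add, coeff_C_mul, coeff_X_pow, hj.ne, if_false, mul_zero, add_zero,
        coeff_zero] using (congrArg (fun R => R.coeff j) eP).symm
    · exact coeff_eq_zero_of_degree_lt (hP.trans_le (by norm_cast; omega))
  have zQ : Q = 0 := by
    ext j
    by_cases hj : j < m
    · simpa only [coeff_add, coeff_C_mul, coeff_X_pow, hj.ne, if_false, mul_zero, add_zero,
        coeff_zero] using (congrArg (fun R => R.coeff j) eQ).symm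
    · exact coeff_eq_zero_of_degree_lt (hQ.trans_le (by norm_cast; omega))
  refine ⟨hspan, s, ?_, ?_⟩
  · rintro rfl
    apply hη
    simpa [zP] using congrArg (fun R => R.coeff (m + 2)) eP
  · rw [e, zP, zQ, show ((0, 0) : F[X] × F[X]) = 0 from rfl, map_zero, add_zero]
end

section
/- Let q be a power of 2, f ∈ 𝔽_q[X] of degree 3, k odd with k ≥ 3, and n = 2k. Let the n points of D be P_{2m−1} = (α_m, β_m) and P_{2m} = (α_m, β_m + 1) for m = 1, …, k, where α_1, …, α_k ∈ 𝔽_q are pairwise distinct and β_m² + β_m = f(α_m); write (α_i, β_i) for the coordinates of P_i. Let η ∈ 𝔽_q^*, v ∈ (𝔽_q^*)^n, and let γ ∈ (𝔽_q^*)^n satisfy the second-type residue relations for D. Assume (Σ_{i=1}^n γ_i α_i^{k−1} β_i, Σ_{i=1}^n γ_i α_i^{k+1}) ≠ (0, 0). Then the twisted generalized elliptic curve code C(D, kO, (k−3)/2, η, v) is self-dual if and only if both: (a) Σ_{i=1}^n γ_i α_i^{k+1} = 0, and (b) there exists λ ∈ 𝔽_q^* such that v_i² = λ·γ_i for all i =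 1, …, n. -/
open Polynomial

/-- The span of a linearly independent family of half the dimension is self-dual
exactly when the family is pairwise orthogonal. -/
lemma span_eq_dual_iff_pairwise_orthogonal {F ι κ : Type*} [Field F] [Fintype ι] [Fintype κ]
    (w : ι → κ → F) (hw : LinearIndependent F w)
    (hcard : Fintype.card κ = 2 * Fintype.card ι) :
    (Submodule.span F (Set.range w) : Set (κ → F)) =
        {u | ∀ c ∈ Submodule.span F (Set.range w), ∑ i, u i * c i = 0} ↔
      ∀ s t, ∑ i, w s i * w t i = 0 := by
  have hset : {u : κ → F | ∀ c ∈ Submodule.span F (Set.range w), ∑ i, u i * c i = 0} =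
      (LinearMap.ker (Matrix.of w).mulVecLin : Set (κ → F)) := by
    ext u
    have hdot (c : κ → F) : ∑ i, u i * c i = dotProductBilin F F u c := rfl
    simp only [Set.mem_ofPred_eq, SetLike.mem_coe, LinearMap.mem_ker, Matrix.mulVecLin_apply]
    constructor
    · intro h
      ext s
      simpa [Matrix.mulVec, dotProduct, mul_comm] using
        h (w s) (Submodule.subset_span ⟨s, rfl⟩)
    · intro h c hc
      have hle : Submodule.span F (Set.range w) ≤ LinearMap.ker (dotProductBilin F F u) := by
        rw [Submodule.span_le]
        rintro _ ⟨s, rfl⟩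
        simpa [Matrix.mulVec, dotProduct, mul_comm, ← hdot] using congrFun h s
      exact hle hc
  rw [hset, SetLike.coe_set_eq]
  constructor
  · intro h s t
    have hs : w s ∈ LinearMap.ker (Matrix.of w).mulVecLin :=
      h ▸ Submodule.subset_span ⟨s, rfl⟩
    rw [LinearMap.mem_ker] at hs
    simpa [Matrix.mulVec, dotProduct, mul_comm] using congrFun hs t
  · intro h
    apply Submodule.eq_of_le_of_finrank_eq
    · rw [Submodule.span_le]
      rintro _ ⟨s, rfl⟩
      rw [SetLike.mem_coe, LinearMap.mem_ker]
      ext t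
      simpa [Matrix.mulVec, dotProduct] using h t s
    · have hrank : (Matrix.of w).rank = Fintype.card ι := hw.rank_matrix
      have hnull := (Matrix.of w).mulVecLin.finrank_range_add_finrank_ker
      rw [Module.finrank_fintype_fun_eq_card, ← Matrix.rank, hrank] at hnull
      rw [finrank_span_eq_card hw]
      omega

/-- A sum over `Fin (2 * k)` split into pairs of consecutive indices. -/
lemma Fin.sum_univ_two_mul {M : Type*} [AddCommMonoid M] (k : ℕ) (g : Fin (2 * k) → M) :
    ∑ i, g i = ∑ m : Fin k, (g ⟨2 * m.val, by have := m.isLt; omega⟩ +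
      g ⟨2 * m.val + 1, by have := m.isLt; omega⟩) := by
  rw [← (finProdFinEquiv.trans (finCongr (mul_comm k 2))).sum_comp g, Fintype.sum_prod_type]
  refine Finset.sum_congr rfl fun m _ => ?_
  rw [Fin.sum_univ_two]
  congr 2 <;> ext <;> simp [add_comm]

/-- A statement about all indices in `Fin (2 * k)` may be checked on pairs. -/
lemma Fin.forall_two_mul {k : ℕ} {p : Fin (2 * k) → Prop}
    (h : ∀ m : Fin k, p ⟨2 * m.val, by have := m.isLt; omega⟩ ∧
      p ⟨2 * m.val + 1, by have := m.isLt; omega⟩) (i : Fin (2 * k)) : p i := by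
  have hi := i.isLt
  rcases Nat.even_or_odd' i.val with ⟨c, hc | hc⟩
  · convert (h ⟨c, by omega⟩).1
  · convert (h ⟨c, by omega⟩).2

/-- A polynomial with `r ≤ k` coefficients vanishing at `k` distinct points is zero. -/
lemma eq_zero_of_sum_mul_pow_eq_zero {F : Type*} [Field F] {k r : ℕ} (hr : r ≤ k)
    {a : Fin k → F} (ha : Function.Injective a) (c : Fin r → F)
    (h : ∀ m, ∑ b, c b * a m ^ (b : ℕ) = 0) : c = 0 :=
  Matrix.eq_zero_of_forall_index_sum_mul_pow_eq_zero
    (ha.comp (Fin.castLE_injective hr)) fun _ => h _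

/-- The monomials `x ^ a` for `a ≤ r` and `x ^ b * y` for `b ≤ s`, evaluated at the points `(α i, β i)`,
where `η * x ^ e` is added to `x ^ s * y`. -/
def twistedGenerator {F κ : Type*} [Field F] (α β : κ → F) (η : F) (r s e : ℕ) :
    Fin (r + 1) ⊕ Fin (s + 1) → κ → F :=
  Sum.elim (fun a i => α i ^ (a : ℕ))
    (fun b i => α i ^ (b : ℕ) * β i + if (b : ℕ) = s then η * α i ^ e else 0)

section Pairs

variable {F : Type*} [Field F] [CharP F 2] {k : ℕ} {αp βp : Fin k → F} {α β : Fin (2 * k) → F}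
    (hα : ∀ m : Fin k, α ⟨2 * m.val, by have := m.isLt; omega⟩ = αp m ∧
          α ⟨2 * m.val + 1, by have := m.isLt; omega⟩ = αp m)
    (hβ : ∀ m : Fin k, β ⟨2 * m.val, by have := m.isLt; omega⟩ = βp m ∧
          β ⟨2 * m.val + 1, by have := m.isLt; omega⟩ = βp m + 1)
    {W : Fin (2 * k) → F} {ω : Fin k → F}

include hα in
/-- If enough power moments vanish, the weights agree on the two points of each pair. -/
lemma eq_on_pairs_of_moments (hαinj : Function.Injective αp)
    (h : ∀ j < k, ∑ i, W i * α i ^ j = 0) (m : Fin k) :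
    W ⟨2 * m.val + 1, by have := m.isLt; omega⟩ = W ⟨2 * m.val, by have := m.isLt; omega⟩ := by
  have hz := Matrix.eq_zero_of_forall_pow_sum_mul_pow_eq_zero
    (v := fun m : Fin k => W ⟨2 * m.val, by have := m.isLt; omega⟩ +
      W ⟨2 * m.val + 1, by have := m.isLt; omega⟩) hαinj (fun j => by
      have := h j j.isLt
      rw [Fin.sum_univ_two_mul] at this
      rw [← this]
      refine Finset.sum_congr rfl fun m _ => ?_
      rw [(hα m).1, (hα m).2, add_mul])
  have hm := congrFun hz m
  exact (CharTwo.add_eq_zero.1 hm).symm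

variable (hW : ∀ m : Fin k, W ⟨2 * m.val, by have := m.isLt; omega⟩ = ω m ∧
          W ⟨2 * m.val + 1, by have := m.isLt; omega⟩ = ω m)

include hα hW in
lemma sum_mul_pow_of_pairs (j : ℕ) : ∑ i, W i * α i ^ j = 0 := by
  rw [Fin.sum_univ_two_mul]
  refine Finset.sum_eq_zero fun m _ => ?_
  rw [(hα m).1, (hα m).2, (hW m).1, (hW m).2, CharTwo.add_self_eq_zero]

include hα hβ hW in
lemma sum_mul_pow_mul_of_pairs (j : ℕ) :
    ∑ i, W i * α i ^ j * β i = ∑ m, ω m * αp m ^ j := by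
  rw [Fin.sum_univ_two_mul]
  refine Finset.sum_congr rfl fun m _ => ?_
  rw [(hα m).1, (hα m).2, (hW m).1, (hW m).2, (hβ m).1, (hβ m).2]
  linear_combination (ω m * αp m ^ j * βp m) * CharTwo.two_eq_zero (R := F)

include hα hβ hW in
lemma sum_twistedGenerator_inl_inr (η : F) (r s e : ℕ) (a : Fin (r + 1)) (b : Fin (s + 1)) :
    ∑ i, W i * (twistedGenerator α β η r s e (.inl a) i *
      twistedGenerator α β η r s e (.inr b) i) = ∑ m, ω m * αp m ^ (a + b : ℕ) := by
  rw [Fin.sum_univ_two_mul]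
  refine Finset.sum_congr rfl fun m _ => ?_
  simp only [twistedGenerator, Sum.elim_inl, Sum.elim_inr]
  rw [(hα m).1, (hα m).2, (hW m).1, (hW m).2, (hβ m).1, (hβ m).2]
  generalize (if (b : ℕ) = s then η * αp m ^ e else 0) = x
  linear_combination (ω m * αp m ^ (a : ℕ) * (αp m ^ (b : ℕ) * βp m + x)) *
    CharTwo.two_eq_zero (R := F)

include hα hβ hW in
lemma sum_twistedGenerator_eq_zero (η : F) {r s e : ℕ}
    (hrs : r + s + 2 ≤ k) (hss : 2 * s + 2 ≤ k) (hse : s + e + 1 ≤ k)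
    (hω : ∀ j : ℕ, j + 2 ≤ k → ∑ m, ω m * αp m ^ j = 0) (x y) :
    ∑ i, W i * (twistedGenerator α β η r s e x i * twistedGenerator α β η r s e y i) = 0 := by
  rcases x with a | b <;> rcases y with a' | b'
  · simp only [twistedGenerator, Sum.elim_inl, ← pow_add]
    exact sum_mul_pow_of_pairs hα hW _
  · rw [sum_twistedGenerator_inl_inr hα hβ hW]
    exact hω _ (by omega)
  · simp_rw [mul_comm (twistedGenerator _ _ _ _ _ _ (.inr b) _)]
    rw [sum_twistedGenerator_inl_inr hα hβ hW]
    exact hω _ (by omega)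
  · have key : ∑ i, W i * (twistedGenerator α β η r s e (.inr b) i *
        twistedGenerator α β η r s e (.inr b') i) =
        ∑ m, ω m * αp m ^ (b + b' : ℕ) +
          ((∑ m, if (b' : ℕ) = s then η * (ω m * αp m ^ (b + e : ℕ)) else 0) +
          ∑ m, if (b : ℕ) = s then η * (ω m * αp m ^ (b' + e : ℕ)) else 0) := by
      rw [Fin.sum_univ_two_mul, ← Finset.sum_add_distrib, ← Finset.sum_add_distrib]
      refine Finset.sum_congr rfl fun m _ => ?_
      simp only [twistedGenerator, Sum.elim_inr]
      rw [(hα m).1, (hα m).2, (hW m).1, (hW m).2, (hβ m).1, (hβ m).2]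
      have h2 := CharTwo.two_eq_zero (R := F)
      have hb (c : ℕ) (d : ℕ) : (if c = s then η * (ω m * αp m ^ (d + e)) else 0) =
          ω m * αp m ^ d * if c = s then η * αp m ^ e else 0 := by
        split_ifs <;> ring
      rw [hb, hb]
      generalize (if (b : ℕ) = s then η * αp m ^ e else 0) = x
      generalize (if (b' : ℕ) = s then η * αp m ^ e else 0) = y
      linear_combination (ω m * (αp m ^ (b + b' : ℕ) * (βp m ^ 2 + βp m) +
        αp m ^ (b : ℕ) * βp m * y + αp m ^ (b' : ℕ) * βp m * x + x * y)) * h2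
    rw [key, hω _ (by omega), zero_add]
    by_cases h : (b : ℕ) = s <;> by_cases h' : (b' : ℕ) = s
    · simp only [h, h', if_true, CharTwo.add_self_eq_zero]
    · simp only [h, h', if_true, if_false, Finset.sum_const_zero, ← Finset.mul_sum]
      rw [hω _ (by omega), mul_zero, zero_add]
    · simp only [h, h', if_true, if_false, Finset.sum_const_zero, ← Finset.mul_sum]
      rw [hω _ (by omega), mul_zero, zero_add]
    · simp [h, h']

omit [CharP F 2] in
include hα hβ in
lemma linearIndependent_twistedGenerator (hαinj : Function.Injective αp) (η : F) {r s e : ℕ}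
    (hr : r + 1 ≤ k) (hs : s + 1 ≤ k) {v : Fin (2 * k) → F} (hv : ∀ i, v i ≠ 0) :
    LinearIndependent F fun x i => v i * twistedGenerator α β η r s e x i := by
  rw [Fintype.linearIndependent_iff]
  intro c hc
  have hpt (i : Fin (2 * k)) : ∑ x, c x * twistedGenerator α β η r s e x i = 0 := by
    have := congrFun hc i
    simp only [Finset.sum_apply, Pi.smul_apply, smul_eq_mul, Pi.zero_apply] at this
    simp_rw [mul_left_comm (c _) (v i), ← Finset.mul_sum] at this
    exact (mul_eq_zero.1 this).resolve_left (hv i)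
  simp only [Fintype.sum_sum_type, twistedGenerator, Sum.elim_inl, Sum.elim_inr] at hpt
  have hd : (fun b => c (.inr b)) = 0 := by
    refine eq_zero_of_sum_mul_pow_eq_zero hs hαinj _ fun m => ?_
    have h0 := hpt ⟨2 * m.val, by have := m.isLt; omega⟩
    have h1 := hpt ⟨2 * m.val + 1, by have := m.isLt; omega⟩
    rw [(hα m).1, (hβ m).1] at h0
    rw [(hα m).2, (hβ m).2] at h1
    have hsub := sub_eq_zero.2 (h1.trans h0.symm)
    rw [add_sub_add_left_eq_sub, ← Finset.sum_sub_distrib] at hsub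
    rw [← hsub]
    exact Finset.sum_congr rfl fun b _ => by ring
  have hc' : (fun a => c (.inl a)) = 0 := by
    refine eq_zero_of_sum_mul_pow_eq_zero hr hαinj _ fun m => ?_
    have h0 := hpt ⟨2 * m.val, by have := m.isLt; omega⟩
    rw [(hα m).1] at h0
    have hd' (b) : c (.inr b) = 0 := congrFun hd b
    simpa [hd'] using h0
  rintro (a | b)
  · exact congrFun hc' a
  · exact congrFun hd b

end Pairs

theorem stmt_11 (F : Type*) [Field F] [Fintype F] (hchar : ringChar F = 2)
    (f : F[X]) (hdeg : f.natDegree = 3)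
    (k : ℕ) (hk : Odd k) (hk3 : 3 ≤ k)
    (αp βp : Fin k → F) (hαinj : Function.Injective αp)
    (hcurve : ∀ m, βp m ^ 2 + βp m = f.eval (αp m))
    (α β : Fin (2 * k) → F)
    (hα : ∀ m : Fin k, α ⟨2 * m.val, by have := m.isLt; omega⟩ = αp m ∧
          α ⟨2 * m.val + 1, by have := m.isLt; omega⟩ = αp m)
    (hβ : ∀ m : Fin k, β ⟨2 * m.val, by have := m.isLt; omega⟩ = βp m ∧
          β ⟨2 * m.val + 1, by have := m.isLt; omega⟩ = βp m + 1)
    (η : F) (hη : η ≠ 0)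
    (v γ : Fin (2 * k) → F) (hv : ∀ i, v i ≠ 0) (hγ : ∀ i, γ i ≠ 0)
    (hres1 : ∀ j : ℕ, 2 * j ≤ 2 * k → ∑ i, γ i * α i ^ j = 0)
    (hres2 : ∀ j : ℕ, 2 * j ≤ 2 * k - 3 → ∑ i, γ i * α i ^ j * β i = 0)
    (hres3 : ∀ j : ℕ, 2 * j ≤ 2 * k - 6 → ∑ i, γ i * α i ^ j * β i ^ 2 = 0)
    (hAB : ¬((∑ i, γ i * α i ^ (k - 1) * β i) = 0 ∧ (∑ i, γ i * α i ^ (k + 1)) = 0))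
    (C : Submodule F (Fin (2 * k) → F))
    (hC : C = Submodule.span F (Set.range (Sum.elim
      (fun (a : Fin ((k - 1) / 2 + 1)) => fun i => v i * α i ^ (a : ℕ))
      (fun (b : Fin ((k - 3) / 2 + 1)) => fun i => v i * (α i ^ (b : ℕ) * β i +
        if (b : ℕ) = (k - 3) / 2 then η * α i ^ ((k + 1) / 2) else 0))))) :
    (C : Set (Fin (2 * k) → F)) = {u | ∀ c ∈ C, ∑ i, u i * c i = 0} ↔
      ((∑ i, γ i * α i ^ (k + 1)) = 0 ∧
        ∃ lam : F, lam ≠ 0 ∧ ∀ i, v i ^ 2 = lam * γ i) := by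
  have : CharP F 2 := ringChar.of_eq hchar
  obtain ⟨t, rfl⟩ : ∃ t, k = 2 * t + 3 := by
    obtain ⟨t, rfl⟩ := hk
    exact ⟨t - 1, by omega⟩
  have hr : (2 * t + 3 - 1) / 2 = t + 1 := by omega
  have hs : (2 * t + 3 - 3) / 2 = t := by omega
  have he : (2 * t + 3 + 1) / 2 = t + 2 := by omega
  rw [hr, hs, he] at hC
  set G := twistedGenerator α β η (t + 1) t (t + 2) with hG
  have hC' : C = Submodule.span F (Set.range fun x i => v i * G x i) := by
    rw [hC]
    congr 2
    ext x i
    rcases x with a | b <;> rfl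
  have hγp (m) := eq_on_pairs_of_moments hα hαinj (fun j hj => hres1 j (by omega)) m
  set g : Fin (2 * t + 3) → F := fun m => γ ⟨2 * m.val, by have := m.isLt; omega⟩
  have hγg : ∀ m : Fin (2 * t + 3), γ ⟨2 * m.val, by have := m.isLt; omega⟩ = g m ∧
      γ ⟨2 * m.val + 1, by have := m.isLt; omega⟩ = g m := fun m => ⟨rfl, hγp m⟩
  have hγsum := sum_mul_pow_of_pairs hα hγg
  have hgsum (j : ℕ) (hj : j + 2 ≤ 2 * t + 3) : ∑ m, g m * αp m ^ j = 0 := by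
    rw [← sum_mul_pow_mul_of_pairs hα hβ hγg]
    exact hres2 j (by omega)
  have hgtop : ∑ m, g m * αp m ^ (2 * t + 2) ≠ 0 := by
    rw [← sum_mul_pow_mul_of_pairs hα hβ hγg]
    exact fun h => hAB ⟨h, hγsum _⟩
  have hsq (x y) : ∑ i, v i * G x i * (v i * G y i) = ∑ i, v i ^ 2 * (G x i * G y i) :=
    Finset.sum_congr rfl fun i _ => by ring
  have hli : LinearIndependent F fun x i => v i * G x i :=
    linearIndependent_twistedGenerator hα hβ hαinj η (by omega) (by omega) hv
  rw [hC', span_eq_dual_iff_pairwise_orthogonal _ hli (by simp; ring)]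
  simp only [hsq]
  constructor
  · intro h
    refine ⟨hγsum _, ?_⟩
    have hvp (m) := eq_on_pairs_of_moments (W := fun i => v i ^ 2) hα hαinj (fun j hj => by
      have := h (.inl ⟨min j (t + 1), by omega⟩) (.inl ⟨j - min j (t + 1), by omega⟩)
      simp only [hG, twistedGenerator, Sum.elim_inl, ← pow_add] at this
      rwa [Nat.add_sub_cancel' (min_le_left _ _)] at this) m
    set w : Fin (2 * t + 3) → F := fun m => v ⟨2 * m.val, by have := m.isLt; omega⟩ ^ 2
    have hwsum (j : ℕ) (hj : j + 2 ≤ 2 * t + 3) : ∑ m, w m * αp m ^ j = 0 := by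
      have := h (.inl ⟨min j (t + 1), by omega⟩) (.inr ⟨j - min j (t + 1), by omega⟩)
      rw [sum_twistedGenerator_inl_inr (W := fun i => v i ^ 2) (ω := w) hα hβ
        (fun m => ⟨rfl, hvp m⟩)] at this
      simpa only [Nat.add_sub_cancel' (min_le_left _ _)] using this
    obtain ⟨lam, hlam⟩ : ∃ lam, lam =
      (∑ m, w m * αp m ^ (2 * t + 2)) / ∑ m, g m * αp m ^ (2 * t + 2) := ⟨_, rfl⟩
    rw [eq_div_iff hgtop] at hlam
    have hwg : (fun m => w m - lam * g m) = 0 := by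
      refine Matrix.eq_zero_of_forall_pow_sum_mul_pow_eq_zero hαinj fun j => ?_
      simp_rw [sub_mul, mul_assoc, Finset.sum_sub_distrib, ← Finset.mul_sum]
      obtain hj | hj : (j : ℕ) + 2 ≤ 2 * t + 3 ∨ (j : ℕ) = 2 * t + 2 := by omega
      · rw [hwsum _ hj, hgsum _ hj, mul_zero, sub_zero]
      · rw [hj, hlam, sub_self]
    have hwg' (m) : w m = lam * g m := sub_eq_zero.1 (congrFun hwg m)
    refine ⟨lam, ?_, Fin.forall_two_mul fun m => ⟨hwg' m, ?_⟩⟩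
    · rintro rfl
      exact pow_ne_zero 2 (hv _) ((hwg' ⟨0, by omega⟩).trans (zero_mul _))
    · rw [(hγg m).2]
      exact (hvp m).trans (hwg' m)
  · rintro ⟨-, lam, -, hlam⟩ x y
    simp_rw [hlam, mul_assoc, ← Finset.mul_sum]
    rw [sum_twistedGenerator_eq_zero hα hβ hγg η (by omega) (by omega) (by omega) hgsum, mul_zero]
end

section
/- Let q be a power of 2, f ∈ 𝔽_q[X] of degree 3, k ≥ 3, and n = 2k. Let D consist of n pairwise distinct affine points P_i = (α_i, β_i) of the curve y² + y = f(x). Suppose the all-ones vector satisfies the second-type residue relations for D, i.e. Σ_{i=1}^n α_i^j = 0 whenever 0 ≤ 2j ≤ n, Σ_{i=1}^n α_i^j β_i = 0 whenever 0 ≤ 2j ≤ n−3, and Σ_{i=1}^n α_i^j β_i² = 0 whenever 0 ≤ 2j ≤ n−6. Then the elliptic curve code C_L(D, kO), i.e. the 𝔽_q-span of ev_D(x^a) for 0 ≤ a ≤ ⌊k/2⌋ and ev_D(x^b y) for 0 ≤ b ≤ ⌊(k−3)/2⌋, is self-dual. -/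
open Polynomial

/-- The form `c² + cd + d² f` with `deg f = 3` is anisotropic over polynomials. -/
lemma eq_zero_of_normForm_eq_zero {F : Type*} [Field F] {f c d : F[X]} (hdeg : f.natDegree = 3)
    (h : c ^ 2 + c * d + d ^ 2 * f = 0) : c = 0 ∧ d = 0 := by
  by_cases hd : d = 0
  · subst hd
    simpa using h
  exfalso
  have hf : f ≠ 0 := by
    rintro rfl
    simp at hdeg
  have h1 : c * (c + d) = -(d ^ 2 * f) := by linear_combination h
  have h2 : (c * (c + d)).natDegree = 2 * d.natDegree + 3 := by
    rw [h1, natDegree_neg, natDegree_mul (pow_ne_zero 2 hd) hf, natDegree_pow, hdeg]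
  have h3 : c * (c + d) ≠ 0 := by
    rw [h1]
    exact neg_ne_zero.mpr (mul_ne_zero (pow_ne_zero 2 hd) hf)
  rw [natDegree_mul (left_ne_zero_of_mul h3) (right_ne_zero_of_mul h3)] at h2
  have h4 := natDegree_add_le c d
  rcases lt_or_ge d.natDegree c.natDegree with h5 | h5
  · rw [natDegree_add_eq_left_of_natDegree_lt h5] at h2
    omega
  · rw [max_eq_right h5] at h4
    omega

/-- At most two points of `y² + y = f(x)` lie above a given abscissa. -/
lemma card_fiber_le_two {F ι : Type*} [Field F] [Fintype ι] [DecidableEq F] {f : F[X]}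
    {α β : ι → F} (hdist : Function.Injective fun i => (α i, β i))
    (hcurve : ∀ i, β i ^ 2 + β i = f.eval (α i)) (a : F) :
    (Finset.univ.filter fun i => a = α i).card ≤ 2 := by
  by_contra! hlt
  obtain ⟨i, j, l, hi, hj, hl, hij, hil, hjl⟩ := Finset.two_lt_card_iff.mp hlt
  simp only [Finset.mem_filter, Finset.mem_univ, true_and] at hi hj hl
  have sum_eq : ∀ m, a = α m → i ≠ m → β i + β m + 1 = 0 := by
    intro m hm him
    have hne : β i - β m ≠ 0 := fun h =>
      him (hdist (Prod.ext (hi.symm.trans hm) (sub_eq_zero.mp h)))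
    refine (mul_eq_zero.mp (?_ : (β i - β m) * (β i + β m + 1) = 0)).resolve_left hne
    have h1 := hcurve i
    have h2 := hcurve m
    rw [← hi] at h1
    rw [← hm] at h2
    linear_combination h1 - h2
  refine hjl (hdist (Prod.ext (hj.symm.trans hl) ?_))
  linear_combination sum_eq j hj hij - sum_eq l hl hil

/-- A function `c(x) + d(x) y` of pole order at most `m` vanishing at more than `m` affine points
of `y² + y = f(x)` is zero. -/
lemma eq_zero_of_eval_eq_zero {F ι : Type*} [Field F] [CharP F 2] [Fintype ι] {f c d : F[X]}
    (hdeg : f.natDegree = 3) {α β : ι → F} (hdist : Function.Injective fun i => (α i, β i))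
    (hcurve : ∀ i, β i ^ 2 + β i = f.eval (α i)) {m : ℕ} (hm : m < Fintype.card ι)
    (hc : 2 * c.natDegree ≤ m) (hd : 2 * d.natDegree + 3 ≤ m)
    (hvan : ∀ i, c.eval (α i) + d.eval (α i) * β i = 0) : c = 0 ∧ d = 0 := by
  classical
  refine eq_zero_of_normForm_eq_zero hdeg ?_
  by_contra hN
  set N := c ^ 2 + c * d + d ^ 2 * f with hNdef
  have two_eq : (2 : F) = 0 := by exact_mod_cast CharP.cast_eq_zero F 2
  have hNdeg : N.natDegree ≤ m := by
    refine natDegree_add_le_of_degree_le (natDegree_add_le_of_degree_le ?_ ?_) ?_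
    · exact natDegree_pow_le.trans hc
    · exact natDegree_mul_le.trans (by omega)
    · refine natDegree_mul_le.trans ?_
      have := natDegree_pow_le (p := d) (n := 2)
      omega
  have hle : Finset.univ.val.map α ≤ N.roots := by
    rw [Multiset.le_iff_count]
    intro a
    rw [Multiset.count_map, count_roots, le_rootMultiplicity_iff hN]
    change (X - C a) ^ (Finset.univ.filter fun i => a = α i).card ∣ N
    have h2 := card_fiber_le_two hdist hcurve a
    rcases lt_or_ge 1 (Finset.univ.filter fun i => a = α i).card with h1 | h1
    · obtain ⟨i, j, hi, hj, hij⟩ := Finset.one_lt_card_iff.mp h1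
      simp only [Finset.mem_filter, Finset.mem_univ, true_and] at hi hj
      have hne : β i - β j ≠ 0 := fun h =>
        hij (hdist (Prod.ext (hi.symm.trans hj) (sub_eq_zero.mp h)))
      have hvi := hvan i
      have hvj := hvan j
      rw [← hi] at hvi
      rw [← hj] at hvj
      have hda : d.eval a = 0 :=
        (mul_eq_zero.mp (by linear_combination hvi - hvj :
          d.eval a * (β i - β j) = 0)).resolve_right hne
      have hca : c.eval a = 0 := by simpa [hda] using hvi
      obtain ⟨c', rfl⟩ := dvd_iff_isRoot.mpr hca
      obtain ⟨d', rfl⟩ := dvd_iff_isRoot.mpr hda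
      refine (pow_dvd_pow _ h2).trans ⟨c' ^ 2 + c' * d' + d' ^ 2 * f, ?_⟩
      rw [hNdef]
      ring
    · rcases Nat.eq_zero_or_pos (Finset.univ.filter fun i => a = α i).card with h0 | h0
      · simp [h0]
      · obtain ⟨i, hi⟩ := Finset.card_pos.mp h0
        simp only [Finset.mem_filter, Finset.mem_univ, true_and] at hi
        refine (pow_dvd_pow _ h1).trans ?_
        rw [pow_one, dvd_iff_isRoot, IsRoot.def, hNdef, hi]
        simp only [eval_add, eval_mul, eval_pow, ← hcurve]
        linear_combination (c.eval (α i) + d.eval (α i) * (β i + 1)) * hvan i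
          - c.eval (α i) * d.eval (α i) * β i * two_eq
  have hcard := (Multiset.card_le_card hle).trans (card_roots' N)
  simp only [Multiset.card_map, Finset.card_val, Finset.card_univ] at hcard
  omega

/-- With respect to the dot product, a self-orthogonal code of half the length is
self-dual. -/
lemma coe_eq_dual_of_finrank {F ι : Type*} [Field F] [Fintype ι] {C : Submodule F (ι → F)}
    (horth : ∀ u ∈ C, ∀ c ∈ C, ∑ i, u i * c i = 0)
    (hdim : Fintype.card ι = 2 * Module.finrank F C) :
    (C : Set (ι → F)) = {u | ∀ c ∈ C, ∑ i, u i * c i = 0} := by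
  classical
  set B := Matrix.toBilin' (1 : Matrix ι ι F) with hB
  have hBapp : ∀ u v, B u v = ∑ i, v i * u i := by
    intro u v
    simp [hB, Matrix.toBilin'_apply', dotProduct, mul_comm]
  have hnd : B.Nondegenerate :=
    LinearMap.BilinForm.nondegenerate_toBilin'_of_det_ne_zero' _ (by simp)
  have hle : C ≤ B.orthogonal C := fun u hu c hc => by
    simpa [hBapp] using horth u hu c hc
  have heq : C = B.orthogonal C := by
    refine Submodule.eq_of_le_of_finrank_le hle ?_
    rw [LinearMap.BilinForm.finrank_orthogonal hnd, Module.finrank_fintype_fun_eq_card]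
    omega
  ext u
  conv_lhs => rw [SetLike.mem_coe, heq]
  simp only [LinearMap.BilinForm.mem_orthogonal_iff, hBapp, Set.mem_ofPred_eq]

theorem stmt_12 (F : Type*) [Field F] [Fintype F] (hchar : ringChar F = 2)
    (f : F[X]) (hdeg : f.natDegree = 3)
    (k : ℕ) (hk3 : 3 ≤ k)
    (α β : Fin (2 * k) → F)
    (hdist : Function.Injective (fun i => (α i, β i)))
    (hcurve : ∀ i, β i ^ 2 + β i = f.eval (α i))
    (hres1 : ∀ j : ℕ, 2 * j ≤ 2 * k → ∑ i, α i ^ j = 0)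
    (hres2 : ∀ j : ℕ, 2 * j ≤ 2 * k - 3 → ∑ i, α i ^ j * β i = 0)
    (hres3 : ∀ j : ℕ, 2 * j ≤ 2 * k - 6 → ∑ i, α i ^ j * β i ^ 2 = 0)
    (C : Submodule F (Fin (2 * k) → F))
    (hC : C = Submodule.span F (Set.range (Sum.elim
      (fun (a : Fin (k / 2 + 1)) => fun i => α i ^ (a : ℕ))
      (fun (b : Fin ((k - 3) / 2 + 1)) => fun i => α i ^ (b : ℕ) * β i)))) :
    (C : Set (Fin (2 * k) → F)) = {u | ∀ c ∈ C, ∑ i, u i * c i = 0} := by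
  have : CharP F 2 := hchar ▸ ringChar.charP F
  have hli : LinearIndependent F (Sum.elim
      (fun (a : Fin (k / 2 + 1)) => fun i => α i ^ (a : ℕ))
      (fun (b : Fin ((k - 3) / 2 + 1)) => fun i => α i ^ (b : ℕ) * β i)) := by
    rw [Fintype.linearIndependent_iff]
    intro g hg
    set c : F[X] := ∑ a : Fin (k / 2 + 1), Polynomial.C (g (Sum.inl a)) * X ^ (a : ℕ) with hc
    set d : F[X] :=
      ∑ b : Fin ((k - 3) / 2 + 1), Polynomial.C (g (Sum.inr b)) * X ^ (b : ℕ) with hd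
    have hcdeg : c.natDegree ≤ k / 2 := natDegree_sum_le_of_forall_le _ _ fun a _ =>
      (natDegree_C_mul_X_pow_le _ _).trans (by omega)
    have hddeg : d.natDegree ≤ (k - 3) / 2 := natDegree_sum_le_of_forall_le _ _ fun b _ =>
      (natDegree_C_mul_X_pow_le _ _).trans (by omega)
    obtain ⟨hc0, hd0⟩ := eq_zero_of_eval_eq_zero (c := c) (d := d) (m := k) hdeg hdist hcurve
      (by simp; omega) (by omega) (by omega) (fun i => by
        have := congrFun hg i
        simpa [hc, hd, eval_finsetSum, Finset.sum_mul, mul_assoc] using this)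
    rintro (a | b)
    · have := congrArg (fun p => coeff p (a : ℕ)) hc0
      simpa [hc, finsetSum_coeff, coeff_X_pow, Fin.val_inj] using this
    · have := congrArg (fun p => coeff p (b : ℕ)) hd0
      simpa [hd, finsetSum_coeff, coeff_X_pow, Fin.val_inj] using this
  have horth : ∀ u ∈ C, ∀ c ∈ C, ∑ i, u i * c i = 0 := by
    subst hC
    intro u hu c hc
    change u ⬝ᵥ c = 0
    induction hu, hc using Submodule.span_induction₂ with
    | mem_mem x y hx hy =>
      obtain ⟨s, rfl⟩ := hx
      obtain ⟨t, rfl⟩ := hy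
      rcases s with a | a <;> rcases t with b | b
      · rw [← hres1 (a + b) (by omega)]
        exact Finset.sum_congr rfl fun i _ => by simp only [Sum.elim_inl]; ring
      · rw [← hres2 (a + b) (by omega)]
        exact Finset.sum_congr rfl fun i _ => by simp only [Sum.elim_inl, Sum.elim_inr]; ring
      · rw [← hres2 (a + b) (by omega)]
        exact Finset.sum_congr rfl fun i _ => by simp only [Sum.elim_inl, Sum.elim_inr]; ring
      · rw [← hres3 (a + b) (by omega)]
        exact Finset.sum_congr rfl fun i _ => by simp only [Sum.elim_inr]; ring
    | zero_left y hy => exact zero_dotProduct y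
    | zero_right x hx => exact dotProduct_zero x
    | add_left x y z hx hy hz h₁ h₂ => rw [add_dotProduct, h₁, h₂, add_zero]
    | add_right x y z hx hy hz h₁ h₂ => rw [dotProduct_add, h₁, h₂, add_zero]
    | smul_left r x y hx hy h => rw [smul_dotProduct, h, smul_zero]
    | smul_right r x y hx hy h => rw [dotProduct_smul, h, smul_zero]
  refine coe_eq_dual_of_finrank horth ?_
  rw [hC, finrank_span_eq_card hli]
  simp only [Fintype.card_fin, Fintype.card_sum]
  omega
end

section
/- Let q be a power of an odd prime, f ∈ 𝔽_q[X] square-free of degree 3, and let D consist of n pairwise distinct affine points of y² = f(x). Let k be odd with 3 ≤ k ≤ n−2, 0 ≤ ℓ ≤ (k−3)/2 and η ∈ 𝔽_q^*, and let T_ℓ = ({0} ∪ {2, 3, …, k+1}) \ {2ℓ+3}. Then the Schur square of the twisted elliptic curve code satisfies dim(C(D, kO, ℓ, η)^{⋆2}) ≥ #{m ∈ ℕ : m < n and m = d₁ + d₂ for some d₁, d₂ ∈ T_ℓ}. -/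
open Polynomial

namespace EllipticCode

variable {F : Type*} [Field F]

/-- The norm `c² - d² f` of the function `c(x) + d(x) y` on the curve `y² = f(x)`. -/
noncomputable def normPoly (f : F[X]) (p : F[X] × F[X]) : F[X] :=
  p.1 ^ 2 - p.2 ^ 2 * f

/-- The product of `c(x) + d(x) y` and `c'(x) + d'(x) y` modulo `y² = f(x)`. -/
noncomputable def mul (f : F[X]) (p q : F[X] × F[X]) : F[X] × F[X] :=
  (p.1 * q.1 + p.2 * q.2 * f, p.1 * q.2 + p.2 * q.1)

theorem normPoly_mul (f : F[X]) (p q : F[X] × F[X]) :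
    normPoly f (mul f p q) = normPoly f p * normPoly f q := by
  simp only [normPoly, mul]
  ring

theorem degree_normPoly {f : F[X]} (hdeg : f.natDegree = 3) (p : F[X] × F[X]) :
    (normPoly f p).degree = max (p.1 ^ 2).degree (p.2 ^ 2 * f).degree := by
  obtain ⟨c, d⟩ := p
  have hf : f ≠ 0 := by
    rintro rfl
    simp at hdeg
  simp only [normPoly]
  by_cases hd : d = 0
  · simp [hd]
  by_cases hc : c = 0
  · simp [hc]
  have hne : (c ^ 2).degree ≠ (d ^ 2 * f).degree := by
    rw [degree_eq_natDegree (pow_ne_zero 2 hc),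
      degree_eq_natDegree (mul_ne_zero (pow_ne_zero 2 hd) hf),
      natDegree_mul (pow_ne_zero 2 hd) hf, natDegree_pow, natDegree_pow, hdeg]
    norm_cast
    omega
  rcases lt_or_gt_of_ne hne with h | h
  · rw [degree_sub_eq_right_of_degree_lt h, max_eq_right h.le]
  · rw [degree_sub_eq_left_of_degree_lt h, max_eq_left h.le]

theorem degree_add_sq_le (c c' : F[X]) :
    ((c + c') ^ 2).degree ≤ max (c ^ 2).degree (c' ^ 2).degree := by
  simp only [sq, degree_mul]
  rcases le_total c.degree c'.degree with h | h
  · have := (degree_add_le c c').trans (max_le h le_rfl)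
    exact le_max_of_le_right (add_le_add this this)
  · have := (degree_add_le c c').trans (max_le le_rfl h)
    exact le_max_of_le_left (add_le_add this this)

theorem degree_normPoly_add_lt {f : F[X]} (hdeg : f.natDegree = 3) {p q : F[X] × F[X]}
    {m : WithBot ℕ} (hp : (normPoly f p).degree < m) (hq : (normPoly f q).degree < m) :
    (normPoly f (p + q)).degree < m := by
  rw [degree_normPoly hdeg, max_lt_iff] at *
  refine ⟨(degree_add_sq_le _ _).trans_lt (max_lt hp.1 hq.1), ?_⟩
  refine lt_of_le_of_lt ?_ (max_lt hp.2 hq.2)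
  simp only [degree_mul]
  rw [← max_add]
  exact add_le_add (degree_add_sq_le _ _) le_rfl

/-- The functions `c(x) + d(x) y` with pole order less than `m` at infinity. -/
noncomputable def poleOrderLT {f : F[X]} (hdeg : f.natDegree = 3) (m : ℕ) :
    Submodule F (F[X] × F[X]) where
  carrier := {p | (normPoly f p).degree < m}
  zero_mem' := by simp [normPoly]
  add_mem' hp hq := degree_normPoly_add_lt hdeg hp hq
  smul_mem' a p hp := by
    have h : normPoly f (a • p) = C (a ^ 2) * normPoly f p := by
      simp only [normPoly, Prod.smul_fst, Prod.smul_snd, smul_eq_C_mul, C_pow]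
      ring
    change (normPoly f (a • p)).degree < m
    rw [h, ← smul_eq_C_mul]
    exact (degree_smul_le _ _).trans_lt hp

theorem mem_poleOrderLT {f : F[X]} (hdeg : f.natDegree = 3) {m : ℕ} {p : F[X] × F[X]} :
    p ∈ poleOrderLT hdeg m ↔ (normPoly f p).degree < m :=
  Iff.rfl

/-- Evaluation of `c(x) + d(x) y` at the points `(α i, β i)`. -/
noncomputable def ev {ι : Type*} (α β : ι → F) : F[X] × F[X] →ₗ[F] (ι → F) where
  toFun p i := p.1.eval (α i) + p.2.eval (α i) * β i
  map_add' p q := by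
    ext i
    simp
    ring
  map_smul' a p := by
    ext i
    simp
    ring

theorem ev_apply {ι : Type*} (α β : ι → F) (p : F[X] × F[X]) (i : ι) :
    ev α β p i = p.1.eval (α i) + p.2.eval (α i) * β i :=
  rfl

theorem ev_mul {ι : Type*} {α β : ι → F} {f : F[X]} (hcurve : ∀ i, β i ^ 2 = f.eval (α i))
    (p q : F[X] × F[X]) : ev α β (mul f p q) = ev α β p * ev α β q := by
  ext i
  simp only [mul, ev_apply, Pi.mul_apply, eval_add, eval_mul, ← hcurve]
  ring

open Classical in
theorem card_fiber_le_rootMultiplicity {ι : Type*} [Fintype ι] {α β : ι → F} {f : F[X]}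
    (hdist : Function.Injective fun i => (α i, β i))
    (hcurve : ∀ i, β i ^ 2 = f.eval (α i)) {p : F[X] × F[X]} (hev : ev α β p = 0)
    (hN : normPoly f p ≠ 0) (a : F) :
    (Finset.univ.filter fun i => α i = a).card ≤ (normPoly f p).rootMultiplicity a := by
  have hz : ∀ i, α i = a → p.1.eval a + p.2.eval a * β i = 0 := by
    rintro i rfl
    exact congrFun hev i
  have hc : ∀ i, α i = a → β i ^ 2 = f.eval a := by
    rintro i rfl
    exact hcurve i
  have hneg : ∀ i j, α i = a → α j = a → i ≠ j → β i = -β j := by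
    intro i j hi hj hij
    refine (sq_eq_sq_iff_eq_or_eq_neg.1 ((hc i hi).trans (hc j hj).symm)).resolve_left ?_
    intro h
    exact hij (hdist (Prod.ext (hi.trans hj.symm) h))
  have hle : (Finset.univ.filter fun i => α i = a).card ≤ 2 := by
    by_contra! h
    obtain ⟨i, j, l, hi, hj, hl, hij, hil, hjl⟩ := Finset.two_lt_card_iff.1 h
    simp only [Finset.mem_filter, Finset.mem_univ, true_and] at hi hj hl
    have h : β j = β l := neg_injective ((hneg i j hi hj hij).symm.trans (hneg i l hi hl hil))
    exact hjl (hdist (Prod.ext (hj.trans hl.symm) h))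
  rw [le_rootMultiplicity_iff hN]
  rcases Nat.lt_or_ge 1 (Finset.univ.filter fun i => α i = a).card with h2 | h1
  · obtain ⟨i, j, hi, hj, hij⟩ := Finset.one_lt_card_iff.1 h2
    simp only [Finset.mem_filter, Finset.mem_univ, true_and] at hi hj
    have hβ : β i - β j ≠ 0 := fun h =>
      hij (hdist (Prod.ext (hi.trans hj.symm) (sub_eq_zero.1 h)))
    have hd : p.2.eval a = 0 := by
      have : p.2.eval a * (β i - β j) = 0 := by linear_combination hz i hi - hz j hj
      exact (mul_eq_zero.1 this).resolve_right hβ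
    have hc0 : p.1.eval a = 0 := by simpa [hd] using hz i hi
    refine (pow_dvd_pow _ hle).trans (dvd_sub ?_ (Dvd.dvd.mul_right ?_ _))
    · exact pow_dvd_pow_of_dvd (dvd_iff_isRoot.2 hc0) 2
    · exact pow_dvd_pow_of_dvd (dvd_iff_isRoot.2 hd) 2
  · rcases Finset.eq_empty_or_nonempty (Finset.univ.filter fun i => α i = a) with h | ⟨i, hi⟩
    · simp [h]
    · simp only [Finset.mem_filter, Finset.mem_univ, true_and] at hi
      refine (pow_dvd_pow _ h1).trans ?_
      rw [pow_one, dvd_iff_isRoot, IsRoot.def, normPoly, eval_sub, eval_mul, eval_pow, eval_pow,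
        ← hc i hi]
      linear_combination (p.1.eval a - p.2.eval a * β i) * hz i hi

theorem normPoly_eq_zero_of_ev_eq_zero {ι : Type*} [Fintype ι] {α β : ι → F} {f : F[X]}
    (hdist : Function.Injective fun i => (α i, β i))
    (hcurve : ∀ i, β i ^ 2 = f.eval (α i)) {p : F[X] × F[X]} (hev : ev α β p = 0)
    (hlt : (normPoly f p).degree < Fintype.card ι) : normPoly f p = 0 := by
  classical
  by_contra hN
  have hle : Finset.univ.val.map α ≤ (normPoly f p).roots := by
    rw [Multiset.le_iff_count]
    intro a
    rw [count_roots, Multiset.count_map]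
    simpa [Finset.card_def, eq_comm] using card_fiber_le_rootMultiplicity hdist hcurve hev hN a
  have hcard := (Multiset.card_le_card hle).trans (card_roots' _)
  rw [degree_eq_natDegree hN, Nat.cast_lt] at hlt
  simp at hcard
  omega

theorem linearIndependent_of_filtration {V : Type*} [AddCommGroup V] [Module F V]
    {W : ℕ → Submodule F V} (hW : Monotone W) {M : Finset ℕ} {v : M → V}
    (hmem : ∀ m : M, v m ∈ W (m + 1)) (hnotMem : ∀ m : M, v m ∉ W m) : LinearIndependent F v := by
  classical
  rw [Fintype.linearIndependent_iff]
  intro g hg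
  by_contra! hne
  obtain ⟨i, hi⟩ := hne
  obtain ⟨m, hm, hmax⟩ := (Finset.univ.filter fun i => g i ≠ 0).exists_max_image id
    ⟨i, by simpa using hi⟩
  simp only [Finset.mem_filter, Finset.mem_univ, true_and, id] at hm hmax
  rw [← Finset.add_sum_erase _ _ (Finset.mem_univ m)] at hg
  have hsum : ∑ j ∈ Finset.univ.erase m, g j • v j ∈ W m := by
    refine Submodule.sum_mem _ fun j hj => ?_
    by_cases h : g j = 0
    · simp [h]
    · have hlt : (j : ℕ) < m := lt_of_le_of_ne (hmax j h) fun h' =>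
        Finset.ne_of_mem_erase hj (Subtype.ext h')
      exact Submodule.smul_mem _ _ (hW hlt (hmem j))
  have hgm : g m • v m ∈ W m := by
    rw [eq_neg_of_add_eq_zero_left hg]
    exact Submodule.neg_mem _ hsum
  exact hnotMem m ((Submodule.smul_mem_iff _ hm).1 hgm)

theorem card_le_finrank_of_poleOrders {ι : Type*} [Fintype ι] {α β : ι → F} {f : F[X]}
    (hdeg : f.natDegree = 3) (hdist : Function.Injective fun i => (α i, β i))
    (hcurve : ∀ i, β i ^ 2 = f.eval (α i)) (S : Submodule F (ι → F)) (M : Finset ℕ)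
    (hlt : ∀ m ∈ M, m < Fintype.card ι)
    (h : ∀ m ∈ M, ∃ p, (normPoly f p).degree = m ∧ ev α β p ∈ S) :
    M.card ≤ Module.finrank F S := by
  choose p hp hS using fun m : M => h m m.2
  have hind : LinearIndependent F fun m => ev α β (p m) := by
    refine linearIndependent_of_filtration (W := fun m => (poleOrderLT hdeg m).map (ev α β))
      (fun m m' hm => Submodule.map_mono fun q hq =>
        (mem_poleOrderLT hdeg).2 (lt_of_lt_of_le hq (Nat.cast_le.2 hm)))
      (fun m => Submodule.mem_map_of_mem ?_) ?_
    · rw [mem_poleOrderLT, hp]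
      exact_mod_cast Nat.lt_succ_self _
    · rintro m ⟨q, hq, hqp⟩
      have hev : ev α β (p m - q) = 0 := by rw [map_sub, hqp, sub_self]
      have hsub : p m - q ∈ poleOrderLT hdeg (Fintype.card ι) := by
        refine Submodule.sub_mem _ ?_ ((mem_poleOrderLT hdeg).2
          (lt_of_lt_of_le hq (Nat.cast_le.2 (hlt m m.2).le)))
        rw [mem_poleOrderLT, hp]
        exact_mod_cast hlt m m.2
      have hzero := normPoly_eq_zero_of_ev_eq_zero hdist hcurve hev hsub
      have hmem : p m - q + q ∈ poleOrderLT hdeg m :=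
        Submodule.add_mem _ (by simp [mem_poleOrderLT, hzero]) hq
      rw [sub_add_cancel, mem_poleOrderLT, hp] at hmem
      exact lt_irrefl _ hmem
  have hS' : LinearIndependent F fun m => (⟨ev α β (p m), hS m⟩ : S) :=
    LinearIndependent.of_comp S.subtype hind
  simpa using hS'.fintype_card_le_finrank

theorem exists_ev_mem_of_poleOrder {n : ℕ} {α β : Fin n → F} {f : F[X]}
    (hdeg : f.natDegree = 3) {k : ℕ} (hk : Odd k) (hk3 : 3 ≤ k) {ℓ : ℕ}
    (hℓ : ℓ ≤ (k - 3) / 2) {η : F} (hη : η ≠ 0) {C : Submodule F (Fin n → F)}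
    (hpow : ∀ a ≤ (k - 1) / 2, (fun i => α i ^ a) ∈ C)
    (hpowy : ∀ b ≤ (k - 3) / 2, (fun i => α i ^ b * β i +
      if b = ℓ then η * α i ^ ((k + 1) / 2) else 0) ∈ C)
    {m : ℕ} (hm : m ∈ (insert 0 (Finset.Icc 2 (k + 1))).erase (2 * ℓ + 3)) :
    ∃ p, (normPoly f p).degree = m ∧ ev α β p ∈ C := by
  have hf : f.degree = 3 := by
    rw [degree_eq_natDegree (by rintro rfl; simp at hdeg), hdeg]
    rfl
  simp only [Finset.mem_erase, Finset.mem_insert, Finset.mem_Icc] at hm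
  obtain ⟨r, rfl⟩ := hk
  by_cases hmk : m = 2 * r + 2
  · subst hmk
    refine ⟨(Polynomial.C η * X ^ (r + 1), X ^ ℓ), ?_, ?_⟩
    · rw [degree_normPoly hdeg, max_eq_left]
      · simp only [degree_pow, degree_mul, degree_C hη, degree_X]
        norm_cast
        simp
      · simp only [degree_pow, degree_mul, degree_C hη, degree_X, hf]
        norm_cast
        simp only [nsmul_eq_mul, Nat.cast_ofNat, mul_one, zero_add]
        have : 2 * ℓ + 3 ≤ 2 * (r + 1) := by omega
        exact_mod_cast this
    · convert hpowy ℓ hℓ using 1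
      ext i
      simp only [ev_apply, eval_mul, eval_C, eval_pow, eval_X, if_true]
      rw [show (2 * r + 1 + 1) / 2 = r + 1 by omega]
      ring
  · rcases Nat.even_or_odd' m with ⟨a, rfl | rfl⟩
    · refine ⟨(X ^ a, 0), ?_, ?_⟩
      · rw [degree_normPoly hdeg]
        simp [← pow_mul, mul_comm]
      · convert hpow a (by omega) using 1
        ext i
        simp [ev_apply]
    · obtain ⟨b, rfl⟩ : ∃ b, a = b + 1 := ⟨a - 1, by omega⟩
      refine ⟨(0, X ^ b), ?_, ?_⟩
      · rw [degree_normPoly hdeg]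
        simp [hf]
        norm_cast
      · convert hpowy b (by omega) using 1
        ext i
        have : b ≠ ℓ := by omega
        simp [ev_apply, this]

end EllipticCode

theorem stmt_14 (F : Type*) [Field F] [Fintype F] (hchar : ringChar F ≠ 2)
    (f : F[X]) (hsf : Squarefree f) (hdeg : f.natDegree = 3)
    (n : ℕ) (α β : Fin n → F)
    (hdist : Function.Injective (fun i => (α i, β i)))
    (hcurve : ∀ i, β i ^ 2 = f.eval (α i))
    (k : ℕ) (hk : Odd k) (hk3 : 3 ≤ k) (hkn : k ≤ n - 2)
    (ℓ : ℕ) (hℓ : ℓ ≤ (k - 3) / 2) (η : F) (hη : η ≠ 0)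
    (C : Submodule F (Fin n → F))
    (hC : C = Submodule.span F (Set.range (Sum.elim
      (fun (a : Fin ((k - 1) / 2 + 1)) => fun i => α i ^ (a : ℕ))
      (fun (b : Fin ((k - 3) / 2 + 1)) => fun i => α i ^ (b : ℕ) * β i +
        if (b : ℕ) = ℓ then η * α i ^ ((k + 1) / 2) else 0))))
    (S2 : Submodule F (Fin n → F))
    (hS2 : S2 = Submodule.span F {w : Fin n → F | ∃ u ∈ C, ∃ u' ∈ C, w = u * u'})
    (Tl : Finset ℕ) (hTl : Tl = (insert 0 (Finset.Icc 2 (k + 1))).erase (2 * ℓ + 3)) :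
    (((Tl ×ˢ Tl).image (fun p => p.1 + p.2)).filter (· < n)).card ≤
      Module.finrank F ↥S2 := by
  have hpow : ∀ a ≤ (k - 1) / 2, (fun i => α i ^ a) ∈ C := by
    intro a ha
    rw [hC]
    exact Submodule.subset_span ⟨Sum.inl ⟨a, by omega⟩, rfl⟩
  have hpowy : ∀ b ≤ (k - 3) / 2, (fun i => α i ^ b * β i +
      if b = ℓ then η * α i ^ ((k + 1) / 2) else 0) ∈ C := by
    intro b hb
    rw [hC]
    exact Submodule.subset_span ⟨Sum.inr ⟨b, by omega⟩, rfl⟩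
  refine EllipticCode.card_le_finrank_of_poleOrders hdeg hdist hcurve S2 _ ?_ ?_
  · intro m hm
    simpa using (Finset.mem_filter.1 hm).2
  · intro m hm
    obtain ⟨⟨m₁, m₂⟩, hm', rfl⟩ := Finset.mem_image.1 (Finset.mem_filter.1 hm).1
    rw [Finset.mem_product, hTl] at hm'
    obtain ⟨p, hp, hpC⟩ :=
      EllipticCode.exists_ev_mem_of_poleOrder hdeg hk hk3 hℓ hη hpow hpowy hm'.1
    obtain ⟨q, hq, hqC⟩ :=
      EllipticCode.exists_ev_mem_of_poleOrder hdeg hk hk3 hℓ hη hpow hpowy hm'.2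
    refine ⟨EllipticCode.mul f p q, ?_, ?_⟩
    · rw [EllipticCode.normPoly_mul, degree_mul, hp, hq, Nat.cast_add]
    · rw [hS2, EllipticCode.ev_mul hcurve]
      exact Submodule.subset_span ⟨_, hpC, _, hqC, rfl⟩
end

section
/- Let q be a power of an odd prime, f ∈ 𝔽_q[X] square-free of degree 3, and let D consist of n pairwise distinct affine points of y² = f(x). Let k be odd with 4 ≤ k ≤ (n−4)/2, let 0 ≤ ℓ ≤ (k−3)/2 and η ∈ 𝔽_q^*. Then the Schur square of the twisted elliptic curve code C = C(D, kO, ℓ, η) satisfies dim(C^{⋆2}) ≥ 2k+1; moreover dim(C^{⋆2}) = 2k+1 if and only if ℓ = (k−3)/2. -/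
open Polynomial

/-- A nonzero function `c(x) + d(x) y` on the curve `y² = f(x)`, where `deg f = 3`, has at most as
many affine zeros as its pole order at infinity. -/
theorem eq_zero_of_eval_add_eval_mul_eq_zero {F : Type*} [Field F] {f : F[X]}
    (hf : f.natDegree = 3) {n : ℕ} {α β : Fin n → F}
    (hdist : Function.Injective fun i => (α i, β i)) (hcurve : ∀ i, β i ^ 2 = f.eval (α i))
    {B : ℕ} (hB : B < n) {c d : F[X]} (hc : 2 * c.natDegree ≤ B) (hd : 2 * d.natDegree + 3 ≤ B)
    (h : ∀ i, c.eval (α i) + d.eval (α i) * β i = 0) : c = 0 ∧ d = 0 := by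
  classical
  have hf0 : f ≠ 0 := by rintro rfl; simp at hf
  by_cases hN : c ^ 2 - d ^ 2 * f = 0
  · have hcd : c ^ 2 = d ^ 2 * f := sub_eq_zero.1 hN
    by_cases hd0 : d = 0
    · subst hd0
      simpa using hcd
    · have := congrArg natDegree hcd
      rw [natDegree_mul (pow_ne_zero 2 hd0) hf0, natDegree_pow, natDegree_pow, hf] at this
      omega
  · exfalso
    have hdeg : (c ^ 2 - d ^ 2 * f).natDegree ≤ B := by
      refine (natDegree_sub_le _ _).trans (max_le ?_ ?_)
      · rwa [natDegree_pow]
      · refine natDegree_mul_le.trans ?_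
        rwa [natDegree_pow, hf]
    have hle : (Finset.univ : Finset (Fin n)).val.map α ≤ (c ^ 2 - d ^ 2 * f).roots := by
      rw [Multiset.le_iff_count]
      intro a
      rw [Multiset.count_map, count_roots]
      change (Finset.univ.filter fun i => a = α i).card ≤ _
      rcases Nat.lt_or_ge 1 (Finset.univ.filter fun i => a = α i).card with hlt | hge
      · obtain ⟨i, hi, j, hj, hij⟩ := Finset.one_lt_card.1 hlt
        simp only [Finset.mem_filter, Finset.mem_univ, true_and] at hi hj
        have hβ : β i ≠ β j := fun hβ => hij (hdist (by simp [← hi, ← hj, hβ]))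
        have h1 := h i
        have h1' := h j
        rw [← hi] at h1
        rw [← hj] at h1'
        have hd0 : d.eval a = 0 := by
          have : d.eval a * (β i - β j) = 0 := by linear_combination h1 - h1'
          exact (mul_eq_zero.1 this).resolve_right (sub_ne_zero.2 hβ)
        have hc0 : c.eval a = 0 := by simpa [hd0] using h1
        have hcard : (Finset.univ.filter fun i => a = α i).card ≤ 2 := by
          refine (Finset.card_le_card_of_injOn (t := {β i, -β i}) β ?_ ?_).trans
            Finset.card_le_two
          · intro l hl
            simp only [Finset.coe_filter, Finset.mem_univ, true_and, Set.mem_ofPred_eq] at hl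
            have : β l ^ 2 = β i ^ 2 := by rw [hcurve, hcurve, ← hl, ← hi]
            simpa using sq_eq_sq_iff_eq_or_eq_neg.1 this
          · intro l hl l' hl' hll
            simp only [Finset.coe_filter, Finset.mem_univ, true_and, Set.mem_ofPred_eq] at hl hl'
            exact hdist (by simp [← hl, ← hl', hll])
        refine hcard.trans ((le_rootMultiplicity_iff hN).2 ?_)
        exact dvd_sub (pow_dvd_pow_of_dvd (dvd_iff_isRoot.2 hc0) 2)
          ((pow_dvd_pow_of_dvd (dvd_iff_isRoot.2 hd0) 2).mul_right f)
      · rcases (Finset.univ.filter fun i => a = α i).eq_empty_or_nonempty with he | ⟨i, hi⟩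
        · simp [he]
        · refine hge.trans ((rootMultiplicity_pos hN).2 ?_)
          simp only [Finset.mem_filter, Finset.mem_univ, true_and] at hi
          have h1 := h i
          have h3 := hcurve i
          rw [← hi] at h1 h3
          simp only [IsRoot, eval_sub, eval_pow, eval_mul, ← h3]
          linear_combination (c.eval a - d.eval a * β i) * h1
    have := (Multiset.card_le_card hle).trans (card_roots' _)
    simp at this
    omega

/-- Evaluation of the function `c(x) + d(x) y` at the points `(α i, β i)`. -/
def evalAtPoints {F : Type*} [Field F] {n : ℕ} (α β : Fin n → F) :
    F[X] × F[X] →ₗ[F] (Fin n → F) where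
  toFun p i := p.1.eval (α i) + p.2.eval (α i) * β i
  map_add' p q := by ext i; simp; ring
  map_smul' a p := by ext i; simp; ring

theorem evalAtPoints_mul {F : Type*} [Field F] {n : ℕ} {α β : Fin n → F} {f : F[X]}
    (hcurve : ∀ i, β i ^ 2 = f.eval (α i)) (p q : F[X] × F[X]) :
    evalAtPoints α β p * evalAtPoints α β q =
      evalAtPoints α β (p.1 * q.1 + p.2 * q.2 * f, p.1 * q.2 + p.2 * q.1) := by
  ext i
  simp only [evalAtPoints, LinearMap.coe_mk, AddHom.coe_mk, Pi.mul_apply, eval_add, eval_mul,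
    ← hcurve]
  ring

theorem finrank_degreeLT (F : Type*) [Field F] (N : ℕ) :
    Module.finrank F (degreeLT F N) = N := by
  rw [(degreeLTEquiv F N).finrank_eq, Module.finrank_fin_fun]

theorem degreeLT_le_of_X_pow_mem {F : Type*} [Field F] {N : ℕ} {T : Submodule F F[X]}
    (h : ∀ j < N, X ^ j ∈ T) : degreeLT F N ≤ T := by
  classical
  rw [degreeLT_eq_span_X_pow, Submodule.span_le]
  intro p hp
  obtain ⟨j, hj, rfl⟩ := Finset.mem_image.1 (Finset.mem_coe.1 hp)
  exact h j (Finset.mem_range.1 hj)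

theorem degreeLT_succ_le_of_mem {F : Type*} [Field F] {N : ℕ} {T : Submodule F F[X]}
    (h : degreeLT F N ≤ T) {p : F[X]} (hp : p ∈ T) (hdeg : p.degree = N) :
    degreeLT F (N + 1) ≤ T := by
  intro q hq
  have hp0 : p.coeff N ≠ 0 := coeff_ne_zero_of_eq_degree hdeg
  have hlt : q - (q.coeff N / p.coeff N) • p ∈ degreeLT F N := by
    rw [mem_degreeLT, degree_lt_iff_coeff_zero] at hq ⊢
    intro j hj
    rcases hj.eq_or_lt with rfl | hj
    · simp [hp0]
    · simp [hq j hj, coeff_eq_zero_of_degree_lt (hdeg.trans_lt (Nat.cast_lt.2 hj))]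
  simpa using T.add_mem (h hlt) (T.smul_mem (q.coeff N / p.coeff N) hp)

theorem prod_le_of_comap_inl_of_comap_inr {F : Type*} [Field F] {N M : ℕ}
    {T : Submodule F (F[X] × F[X])} (hN : degreeLT F N ≤ T.comap (LinearMap.inl F _ _))
    (hM : degreeLT F M ≤ T.comap (LinearMap.inr F _ _)) :
    (degreeLT F N).prod (degreeLT F M) ≤ T := by
  rintro ⟨c, d⟩ ⟨hc, hd⟩
  simpa using T.add_mem (hN hc) (hM hd)

theorem injOn_evalAtPoints {F : Type*} [Field F] {f : F[X]}
    (hf : f.natDegree = 3) {n : ℕ} {α β : Fin n → F}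
    (hdist : Function.Injective fun i => (α i, β i)) (hcurve : ∀ i, β i ^ 2 = f.eval (α i))
    {B : ℕ} (hB : B < n) {N M : ℕ} (hN : 2 * N ≤ B) (hM : 2 * M + 3 ≤ B) :
    Set.InjOn (evalAtPoints α β) ((degreeLT F (N + 1)).prod (degreeLT F (M + 1))) := by
  rintro ⟨c, d⟩ ⟨hc, hd⟩ ⟨c', d'⟩ ⟨hc', hd'⟩ h
  have hc₀ := sub_mem hc hc'
  have hd₀ := sub_mem hd hd'
  simp only [mem_degreeLT, degree_lt_iff_coeff_zero] at hc₀ hd₀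
  have h1 : (c - c').natDegree ≤ N :=
    natDegree_le_iff_coeff_eq_zero.2 fun j hj => hc₀ j (by omega)
  have h2 : (d - d').natDegree ≤ M :=
    natDegree_le_iff_coeff_eq_zero.2 fun j hj => hd₀ j (by omega)
  obtain ⟨e1, e2⟩ := eq_zero_of_eval_add_eval_mul_eq_zero hf hdist hcurve hB
    (c := c - c') (d := d - d') (by omega) (by omega) fun i => by
      have := congrFun h i
      simp only [evalAtPoints, LinearMap.coe_mk, AddHom.coe_mk] at this
      simp only [eval_sub]
      linear_combination this
  exact Prod.ext (sub_eq_zero.1 e1) (sub_eq_zero.1 e2)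

theorem finrank_map_evalAtPoints {F : Type*} [Field F] {f : F[X]}
    (hf : f.natDegree = 3) {n : ℕ} {α β : Fin n → F}
    (hdist : Function.Injective fun i => (α i, β i)) (hcurve : ∀ i, β i ^ 2 = f.eval (α i))
    {B : ℕ} (hB : B < n) {N M : ℕ} (hN : 2 * N ≤ B) (hM : 2 * M + 3 ≤ B) :
    Module.finrank F (((degreeLT F (N + 1)).prod (degreeLT F (M + 1))).map (evalAtPoints α β)) =
      N + M + 2 := by
  have := Module.Finite.equiv (degreeLTEquiv F (N + 1)).symm
  have := Module.Finite.equiv (degreeLTEquiv F (M + 1)).symm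
  have hrange : ((degreeLT F (N + 1)).prod (degreeLT F (M + 1))).map (evalAtPoints α β) =
      LinearMap.range ((evalAtPoints α β).comp
        ((degreeLT F (N + 1)).subtype.prodMap (degreeLT F (M + 1)).subtype)) := by
    rw [LinearMap.range_comp, LinearMap.range_prodMap, Submodule.range_subtype,
      Submodule.range_subtype]
  rw [hrange, LinearMap.finrank_range_of_inj, Module.finrank_prod, finrank_degreeLT,
    finrank_degreeLT]
  · ring
  · rintro ⟨c, d⟩ ⟨c', d'⟩ h
    have := injOn_evalAtPoints hf hdist hcurve hB hN hM ⟨c.2, d.2⟩ ⟨c'.2, d'.2⟩ h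
    exact Prod.ext (Subtype.ext (congrArg Prod.fst this)) (Subtype.ext (congrArg Prod.snd this))

section SquareContains

variable {F : Type*} [Field F] {f : F[X]} {m ℓ : ℕ} {η : F} {K T : Submodule F (F[X] × F[X])}

theorem X_pow_mul_mem_degreeLT (hf : f.natDegree = 3) {j N : ℕ} (h : j + 4 ≤ N) :
    X ^ j * f ∈ degreeLT F N := by
  rw [mem_degreeLT]
  refine (degree_le_natDegree.trans (Nat.cast_le.2 (natDegree_mul_le (p := X ^ j)))).trans_lt ?_
  rw [natDegree_X_pow, hf]
  exact_mod_cast (by omega : j + 3 < N)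

theorem X_pow_mem_degreeLT {j N : ℕ} (h : j < N) : (X ^ j : F[X]) ∈ degreeLT F N := by
  rw [mem_degreeLT, degree_X_pow]
  exact_mod_cast h

theorem degree_X_pow_mul (hf : f.natDegree = 3) (j : ℕ) :
    (X ^ j * f).degree = ((j + 3 : ℕ) : WithBot ℕ) := by
  have hf0 : f ≠ 0 := by rintro rfl; simp at hf
  rw [degree_mul, degree_X_pow, degree_eq_natDegree hf0, hf]
  rfl

theorem degreeLT_le_comap_inl_of_mul_mem
    (hT : ∀ p ∈ K, ∀ q ∈ K, (p.1 * q.1 + p.2 * q.2 * f, p.1 * q.2 + p.2 * q.1) ∈ T)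
    (hX : ∀ a ≤ m, (X ^ a, 0) ∈ K) :
    degreeLT F (2 * m + 1) ≤ T.comap (LinearMap.inl F _ _) := by
  refine degreeLT_le_of_X_pow_mem fun j hj => ?_
  have := hT _ (hX (j / 2) (by omega)) _ (hX (j - j / 2) (by omega))
  simpa [← pow_add, show j / 2 + (j - j / 2) = j by omega] using this

/-- If `y`-monomials of degree below `m - 1` may skip one exponent `ℓ < m - 1`, the products fill
the whole space of functions with pole order at most `4 m + 4`. -/
theorem prod_degreeLT_le_of_lt (hf : f.natDegree = 3) (hη : η ≠ 0) (h2 : ℓ + 2 ≤ m)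
    (hT : ∀ p ∈ K, ∀ q ∈ K, (p.1 * q.1 + p.2 * q.2 * f, p.1 * q.2 + p.2 * q.1) ∈ T)
    (hX : ∀ a ≤ m, (X ^ a, 0) ∈ K) (hY : ∀ b < m, b ≠ ℓ → (0, X ^ b) ∈ K)
    (hg : (C η * X ^ (m + 1), X ^ ℓ) ∈ K) :
    (degreeLT F (2 * m + 3)).prod (degreeLT F (2 * m + 1)) ≤ T := by
  have hinl := degreeLT_le_comap_inl_of_mul_mem hT hX
  have hXY : ∀ a ≤ m, ∀ b < m, (0, X ^ (a + b)) ∈ T := by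
    intro a ha b hb
    by_cases hbℓ : b = ℓ
    · rcases Nat.eq_zero_or_pos a with rfl | ha0
      · have h1 := hT _ (hX 0 (by omega)) _ hg
        have h3 : (C η * X ^ (m + 1), 0) ∈ T := by
          rw [← smul_eq_C_mul]
          exact hinl ((degreeLT F _).smul_mem _ (X_pow_mem_degreeLT (by omega)))
        have := T.sub_mem h1 h3
        simpa [hbℓ] using this
      · have := hT _ (hX (a - 1) (by omega)) _ (hY (b + 1) (by omega) (by omega))
        simpa [← pow_add, show a - 1 + (b + 1) = a + b by omega] using this
    · simpa [← pow_add] using hT _ (hX a ha) _ (hY b hb hbℓ)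
  have hYlow : degreeLT F (2 * m) ≤ T.comap (LinearMap.inr F _ _) := by
    refine degreeLT_le_of_X_pow_mem fun j hj => ?_
    simpa [show j - j / 2 + j / 2 = j by omega] using
      hXY (j - j / 2) (by omega) (j / 2) (by omega)
  have hinl' : degreeLT F (2 * m + 2) ≤ T.comap (LinearMap.inl F _ _) := by
    refine degreeLT_succ_le_of_mem hinl (p := X ^ (2 * (m - 1)) * f) ?_ ?_
    · have h1 := hY (m - 1) (by omega) (by omega)
      simpa [← pow_add, ← two_mul] using hT _ h1 _ h1
    · rw [degree_X_pow_mul hf]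
      congr 1
      omega
  have hYtop : degreeLT F (2 * m + 1) ≤ T.comap (LinearMap.inr F _ _) := by
    refine degreeLT_succ_le_of_mem hYlow (p := C η * X ^ (2 * m)) ?_ (degree_C_mul_X_pow _ hη)
    have h1 := T.sub_mem (hT _ hg _ (hY (m - 1) (by omega) (by omega)))
      (hinl (X_pow_mul_mem_degreeLT hf (j := ℓ + (m - 1)) (by omega)))
    simpa [mul_assoc, ← pow_add, show m + 1 + (m - 1) = 2 * m by omega] using h1
  refine prod_le_of_comap_inl_of_comap_inr ?_ hYtop
  refine degreeLT_succ_le_of_mem hinl' (p := C (η ^ 2) * X ^ (2 * m + 2) + X ^ (2 * ℓ) * f) ?_ ?_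
  · have h1 : (2 * η) • X ^ (ℓ + m + 1) ∈ degreeLT F (2 * m + 1) :=
      (degreeLT F _).smul_mem _ (X_pow_mem_degreeLT (by omega))
    have h3 := T.sub_mem (hT _ hg _ hg) (hYtop h1)
    rw [Submodule.mem_comap]
    convert h3 using 1
    ext1
    · simp
      ring
    · simp [smul_eq_C_mul, C_ofNat]
      ring
  · rw [degree_add_eq_left_of_degree_lt] <;> rw [degree_C_mul_X_pow _ (pow_ne_zero 2 hη)]
    rw [degree_X_pow_mul hf]
    exact_mod_cast (by omega : 2 * ℓ + 3 < 2 * m + 2)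

/-- If `y`-monomials skip only the exponent `m - 1`, the products still contain all functions with
pole order at most `4 m + 2`. -/
theorem prod_degreeLT_le_of_eq (hf : f.natDegree = 3) (hη : η ≠ 0) (h1 : 1 ≤ ℓ) (h2 : ℓ + 1 = m)
    (hT : ∀ p ∈ K, ∀ q ∈ K, (p.1 * q.1 + p.2 * q.2 * f, p.1 * q.2 + p.2 * q.1) ∈ T)
    (hX : ∀ a ≤ m, (X ^ a, 0) ∈ K) (hY : ∀ b < m, b ≠ ℓ → (0, X ^ b) ∈ K)
    (hg : (C η * X ^ (m + 1), X ^ ℓ) ∈ K) :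
    (degreeLT F (2 * m + 2)).prod (degreeLT F (2 * m)) ≤ T := by
  have hinl := degreeLT_le_comap_inl_of_mul_mem hT hX
  have hYlow : degreeLT F (2 * ℓ + 1) ≤ T.comap (LinearMap.inr F _ _) := by
    refine degreeLT_le_of_X_pow_mem fun j hj => ?_
    have := hT _ (hX (min j m) (by omega)) _ (hY (j - min j m) (by omega) (by omega))
    simpa [← pow_add, show min j m + (j - min j m) = j by omega] using this
  have hYtop : degreeLT F (2 * ℓ + 1 + 1) ≤ T.comap (LinearMap.inr F _ _) := by
    refine degreeLT_succ_le_of_mem hYlow (p := C η * X ^ (2 * ℓ + 1)) ?_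
      (degree_C_mul_X_pow _ hη)
    have h1 := T.sub_mem (hT _ hg _ (hY (ℓ - 1) (by omega) (by omega)))
      (hinl (X_pow_mul_mem_degreeLT hf (j := ℓ + (ℓ - 1)) (by omega)))
    simpa [mul_assoc, ← pow_add, show m + 1 + (ℓ - 1) = 2 * ℓ + 1 by omega] using h1
  rw [show 2 * ℓ + 1 + 1 = 2 * m by omega] at hYtop
  refine prod_le_of_comap_inl_of_comap_inr ?_ hYtop
  refine degreeLT_succ_le_of_mem hinl (p := C η * X ^ (2 * m + 1)) ?_ (degree_C_mul_X_pow _ hη)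
  have h3 := T.sub_mem (hT _ hg _ (hX m le_rfl))
    (hYtop (X_pow_mem_degreeLT (show ℓ + m < 2 * m by omega)))
  simpa [mul_assoc, ← pow_add, show m + 1 + m = 2 * m + 1 by omega] using h3

/-- All products of generators except the square of the twisted one have pole order at most
`4 m + 2`. -/
theorem mul_mem_prod_degreeLT (hf : f.natDegree = 3) (h2 : ℓ + 1 = m)
    {p q : F[X] × F[X]}
    (hp : (∃ a ≤ m, p = (X ^ a, 0)) ∨ (∃ b < ℓ, p = (0, X ^ b)) ∨
      p = (C η * X ^ (m + 1), X ^ ℓ))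
    (hq : (∃ a ≤ m, q = (X ^ a, 0)) ∨ (∃ b < ℓ, q = (0, X ^ b)) ∨
      q = (C η * X ^ (m + 1), X ^ ℓ)) :
    (p.1 * q.1 + p.2 * q.2 * f, p.1 * q.2 + p.2 * q.1) ∈
        (degreeLT F (2 * m + 2)).prod (degreeLT F (2 * m)) ∨
      p = (C η * X ^ (m + 1), X ^ ℓ) ∧ q = (C η * X ^ (m + 1), X ^ ℓ) := by
  have hX : ∀ {N j : ℕ}, j < N → (X ^ j : F[X]) ∈ degreeLT F N := X_pow_mem_degreeLT
  have hXf : ∀ {N j : ℕ}, j + 4 ≤ N → X ^ j * f ∈ degreeLT F N := X_pow_mul_mem_degreeLT hf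
  have hCX : ∀ {N i j : ℕ}, i + j < N → C η * X ^ i * X ^ j ∈ degreeLT F N := fun h => by
    rw [mul_assoc, ← pow_add, ← smul_eq_C_mul]
    exact (degreeLT F _).smul_mem _ (X_pow_mem_degreeLT h)
  have hXC : ∀ {N i j : ℕ}, i + j < N → X ^ j * (C η * X ^ i) ∈ degreeLT F N := fun h => by
    rw [mul_comm]
    exact hCX h
  rcases hp with ⟨a, ha, rfl⟩ | ⟨b, hb, rfl⟩ | rfl <;>
    rcases hq with ⟨a', ha', rfl⟩ | ⟨b', hb', rfl⟩ | rfl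
  on_goal 9 => exact Or.inr ⟨rfl, rfl⟩
  all_goals
    left
    simp only [Submodule.mem_prod, mul_zero, zero_mul, add_zero, zero_add, ← pow_add]
    constructor
  all_goals first
    | with_reducible exact zero_mem _
    | with_reducible exact hX (by omega)
    | with_reducible exact hXf (by omega)
    | with_reducible exact hCX (by omega)
    | with_reducible exact hXC (by omega)

end SquareContains

theorem stmt_15 (F : Type*) [Field F] [Fintype F] (hchar : ringChar F ≠ 2)
    (f : F[X]) (hsf : Squarefree f) (hdeg : f.natDegree = 3)
    (n : ℕ) (α β : Fin n → F)
    (hdist : Function.Injective (fun i => (α i, β i)))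
    (hcurve : ∀ i, β i ^ 2 = f.eval (α i))
    (k : ℕ) (hk : Odd k) (hk4 : 4 ≤ k) (hkn : k ≤ (n - 4) / 2)
    (ℓ : ℕ) (hℓ : ℓ ≤ (k - 3) / 2) (η : F) (hη : η ≠ 0)
    (C : Submodule F (Fin n → F))
    (hC : C = Submodule.span F (Set.range (Sum.elim
      (fun (a : Fin ((k - 1) / 2 + 1)) => fun i => α i ^ (a : ℕ))
      (fun (b : Fin ((k - 3) / 2 + 1)) => fun i => α i ^ (b : ℕ) * β i +
        if (b : ℕ) = ℓ then η * α i ^ ((k + 1) / 2) else 0))))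
    (S2 : Submodule F (Fin n → F))
    (hS2 : S2 = Submodule.span F {w : Fin n → F | ∃ u ∈ C, ∃ u' ∈ C, w = u * u'}) :
    2 * k + 1 ≤ Module.finrank F ↥S2 ∧
      (Module.finrank F ↥S2 = 2 * k + 1 ↔ ℓ = (k - 3) / 2) := by
  obtain ⟨m, rfl⟩ := hk
  have e : (2 * m + 1 + 1) / 2 = m + 1 := by omega
  rw [e] at hC
  set ev := evalAtPoints α β with hev
  set g : F[X] × F[X] := (Polynomial.C η * X ^ (m + 1), X ^ ℓ) with hgdef
  have hX : ∀ a ≤ m, (X ^ a, 0) ∈ C.comap ev := fun a ha => by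
    rw [hC]
    exact Submodule.subset_span ⟨Sum.inl ⟨a, by omega⟩, by ext i; simp [hev, evalAtPoints]⟩
  have hY : ∀ b < m, b ≠ ℓ → (0, X ^ b) ∈ C.comap ev := fun b hb hbℓ => by
    rw [hC]
    exact Submodule.subset_span
      ⟨Sum.inr ⟨b, by omega⟩, by ext i; simp [hev, evalAtPoints, hbℓ]⟩
  have hg : g ∈ C.comap ev := by
    rw [hC]
    exact Submodule.subset_span
      ⟨Sum.inr ⟨ℓ, by omega⟩, by ext i; simp [hev, evalAtPoints, hgdef, add_comm]⟩
  have hT : ∀ p ∈ C.comap ev, ∀ q ∈ C.comap ev,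
      (p.1 * q.1 + p.2 * q.2 * f, p.1 * q.2 + p.2 * q.1) ∈ S2.comap ev := fun p hp q hq => by
    rw [hS2]
    exact Submodule.subset_span ⟨_, hp, _, hq, (evalAtPoints_mul hcurve p q).symm⟩
  by_cases hℓm : ℓ + 1 = m
  · suffices h : Module.finrank F S2 = 2 * (2 * m + 1) + 1 by omega
    have hS : S2 = ((degreeLT F (2 * m + 1 + 1)).prod (degreeLT F (2 * ℓ + 1 + 1))).map ev ⊔
        Submodule.span F {ev g * ev g} := by
      have e2 : 2 * ℓ + 1 + 1 = 2 * m := by omega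
      rw [e2]
      apply le_antisymm
      · have hgen : ∀ u ∈ Set.range (Sum.elim
            (fun (a : Fin ((2 * m + 1 - 1) / 2 + 1)) => fun i => α i ^ (a : ℕ))
            (fun (b : Fin ((2 * m + 1 - 3) / 2 + 1)) => fun i => α i ^ (b : ℕ) * β i +
              if (b : ℕ) = ℓ then η * α i ^ (m + 1) else 0)),
            ∃ p : F[X] × F[X], ev p = u ∧ ((∃ a ≤ m, p = (X ^ a, 0)) ∨
              (∃ b < ℓ, p = (0, X ^ b)) ∨ p = g) := by
          rintro _ ⟨⟨a, ha⟩ | ⟨b, hb⟩, rfl⟩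
          · exact ⟨(X ^ a, 0), by ext i; simp [hev, evalAtPoints],
              Or.inl ⟨a, by omega, rfl⟩⟩
          · by_cases hbℓ : b = ℓ
            · exact ⟨g, by ext i; simp [hev, evalAtPoints, hgdef, hbℓ, add_comm],
                Or.inr (Or.inr rfl)⟩
            · exact ⟨(0, X ^ b), by ext i; simp [hev, evalAtPoints, hbℓ],
                Or.inr (Or.inl ⟨b, by omega, rfl⟩)⟩
        rw [hS2, Submodule.span_le]
        rintro _ ⟨u, hu, u', hu', rfl⟩
        have hmul : u * u' ∈ C * C := Submodule.mul_mem_mul hu hu'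
        rw [hC, Submodule.span_mul_span] at hmul
        refine Submodule.span_le.2 ?_ hmul
        rintro _ ⟨_, hv, _, hv', rfl⟩
        obtain ⟨p, rfl, hp⟩ := hgen _ hv
        obtain ⟨q, rfl, hq⟩ := hgen _ hv'
        rcases mul_mem_prod_degreeLT hdeg hℓm hp hq with h | ⟨rfl, rfl⟩
        · refine Submodule.mem_sup_left ⟨_, h, (evalAtPoints_mul hcurve p q).symm⟩
        · exact Submodule.mem_sup_right (Submodule.mem_span_singleton_self _)
      · refine sup_le (Submodule.map_le_iff_le_comap.2
          (prod_degreeLT_le_of_eq hdeg hη (by omega) hℓm hT hX hY hg)) ?_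
        rw [Submodule.span_singleton_le_iff_mem, hS2]
        exact Submodule.subset_span ⟨_, hg, _, hg, rfl⟩
    have hnot : ev g * ev g ∉
        ((degreeLT F (2 * m + 1 + 1)).prod (degreeLT F (2 * ℓ + 1 + 1))).map ev := by
      rintro ⟨p, hp, hpg⟩
      rw [hev, evalAtPoints_mul hcurve] at hpg
      have hle : ∀ {N : ℕ} {r : F[X]}, r.natDegree < N → r ∈ degreeLT F N := fun {N r} hr =>
        mem_degreeLT.2 (degree_le_natDegree.trans_lt (by exact_mod_cast hr))
      have hsq : g.1 * g.2 + g.2 * g.1 = Polynomial.C (2 * η) * X ^ (2 * m) := by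
        rw [hgdef, ← hℓm, C_mul, C_ofNat]
        ring
      have hcoeff : (g.1 * g.2 + g.2 * g.1).coeff (2 * m) ≠ 0 := by
        rw [hsq, coeff_C_mul_X_pow, if_pos rfl]
        exact mul_ne_zero (Ring.two_ne_zero hchar) hη
      have hpg' := injOn_evalAtPoints hdeg hdist hcurve (B := 4 * m + 4) (by omega)
        (N := 2 * m + 2) (M := 2 * m) (by omega) (by omega)
        ⟨degreeLT_mono (by omega) hp.1, degreeLT_mono (by omega) hp.2⟩ ⟨?_, ?_⟩ hpg
      · refine hcoeff ?_
        rw [← show p.2 = g.1 * g.2 + g.2 * g.1 from congrArg Prod.snd hpg']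
        exact coeff_eq_zero_of_degree_lt ((mem_degreeLT.1 hp.2).trans_le
          (by exact_mod_cast (by omega : 2 * ℓ + 1 + 1 ≤ 2 * m)))
      · refine hle (Nat.lt_succ_of_le ?_)
        simp only [hgdef]
        compute_degree
        omega
      · refine hle ?_
        change natDegree (g.1 * g.2 + g.2 * g.1) < _
        rw [hsq]
        exact Nat.lt_succ_of_le (natDegree_C_mul_X_pow_le _ _)
    rw [hS, Submodule.finrank_sup_span_singleton hnot,
      finrank_map_evalAtPoints hdeg hdist hcurve (B := 4 * m + 4) (by omega) (by omega) (by omega)]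
    omega
  · have h := Submodule.finrank_mono (Submodule.map_le_iff_le_comap.2
      (prod_degreeLT_le_of_lt hdeg hη (by omega) hT hX hY hg))
    rw [finrank_map_evalAtPoints hdeg hdist hcurve (B := 4 * m + 4) (N := 2 * m + 2) (M := 2 * m)
      (by omega) (by omega) (by omega)] at h
    omega
end
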